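/- Let N ⊆ M be an inclusion of hyperfinite II₁ factors such that the relative commutant N' ∩ M equals ℂ1 (i.e. the inclusion is irreducible), and let ω be a free ultrafilter on ℕ. If the central sequence algebra M' ∩ M^ω is contained in the ultrapower N^ω, then N = M. -/

import Mathlib

open scoped ComplexOrder
open Filter

namespace PopaQ

variable {H : Type u} [NormedAddCommGroup H] [InnerProductSpace ℂ H] [CompleteSpace H]

/-- Bounded operators on `H`. -/
abbrev Op (H : Type u) [NormedAddCommGroup H] [InnerProductSpace ℂ H] [CompleteSpace H] :=
  H →L[ℂ] H

/-- The relative commutant `N' ∩ M` (as sets of operators). -/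
def relComm (N M : Set (Op H)) : Set (Op H) :=
  {x | x ∈ M ∧ ∀ y ∈ N, y * x = x * y}

/-- The scalar operators `ℂ 1`. -/
def scalars (H : Type u) [NormedAddCommGroup H] [InnerProductSpace ℂ H] [CompleteSpace H] :
    Set (Op H) :=
  {x | ∃ c : ℂ, x = c • (1 : Op H)}

/-- A (self-adjoint) projection. -/
def IsProjection (p : Op H) : Prop :=
  IsSelfAdjoint p ∧ IsIdempotentElem p

/-- `τ` is a faithful tracial state on `M`. -/
structure IsTracialState (M : Set (Op H)) (τ : Op H →ₗ[ℂ] ℂ) : Prop where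
  map_one : τ 1 = 1
  tracial : ∀ x ∈ M, ∀ y ∈ M, τ (x * y) = τ (y * x)
  pos : ∀ x ∈ M, 0 ≤ τ (star x * x)
  faithful : ∀ x ∈ M, τ (star x * x) = 0 → x = 0

/-- A set of operators is finite dimensional as a complex vector space. -/
def FinDim (S : Set (Op H)) : Prop :=
  ∃ s : Finset (Op H), S ⊆ (Submodule.span ℂ (s : Set (Op H)) : Set (Op H))

/-- `M` is a II₁ factor with faithful normal trace `τ`:
a factor (trivial center) carrying a faithful tracial state, which is
infinite dimensional. -/
structure IsII1Factor (M : VonNeumannAlgebra H) (τ : Op H →ₗ[ℂ] ℂ) : Prop where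
  factor : relComm (M : Set (Op H)) (M : Set (Op H)) = scalars H
  trace : IsTracialState (M : Set (Op H)) τ
  infdim : ¬ FinDim (M : Set (Op H))

/-- `M` is hyperfinite: it is the (weak closure = double commutant) of an increasing
union of finite-dimensional *-subalgebras. -/
def IsHyperfinite (M : VonNeumannAlgebra H) : Prop :=
  ∃ A : ℕ → StarSubalgebra ℂ (Op H),
    Monotone A ∧ (∀ n, (A n : Set (Op H)) ⊆ M) ∧ (∀ n, FinDim (A n : Set (Op H))) ∧
    Set.centralizer (Set.centralizer (⋃ n, (A n : Set (Op H)))) = (M : Set (Op H))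

/-- A bounded sequence of operators. -/
def Bdd (x : ℕ → Op H) : Prop :=
  ∃ C : ℝ, ∀ n, ‖x n‖ ≤ C

/-- A sequence taking values in `S`. -/
def SeqIn (S : Set (Op H)) (x : ℕ → Op H) : Prop :=
  ∀ n, x n ∈ S

/-- A free ultrafilter on ℕ. -/
def IsFreeUltrafilter (ω : Ultrafilter ℕ) : Prop :=
  ∀ s : Set ℕ, s.Finite → s ∉ ω

/-- `Mω` is the tracial ultrapower of `M` along `ω`, with trace `τ`;
`limω` assigns to each bounded sequence in `M` its class in `Mω` (the diagonal
embedding of `M` into `Mω` being the identity on `M`). -/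
structure IsTracialUltrapower (ω : Ultrafilter ℕ) (M Mω : VonNeumannAlgebra H)
    (τ : Op H →ₗ[ℂ] ℂ) (limω : (ℕ → Op H) → Op H) : Prop where
  subset : (M : Set (Op H)) ⊆ (Mω : Set (Op H))
  mem : ∀ x, SeqIn (M : Set (Op H)) x → Bdd x → limω x ∈ Mω
  diag : ∀ m ∈ M, limω (fun _ => m) = m
  map_add : ∀ x y, SeqIn (M : Set (Op H)) x → Bdd x → SeqIn (M : Set (Op H)) y → Bdd y →
    limω (fun n => x n + y n) = limω x + limω y
  map_mul : ∀ x y, SeqIn (M : Set (Op H)) x → Bdd x → SeqIn (M : Set (Op H)) y → Bdd y →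
    limω (fun n => x n * y n) = limω x * limω y
  map_smul : ∀ (c : ℂ) x, SeqIn (M : Set (Op H)) x → Bdd x →
    limω (fun n => c • x n) = c • limω x
  map_star : ∀ x, SeqIn (M : Set (Op H)) x → Bdd x →
    limω (fun n => star (x n)) = star (limω x)
  surj : ∀ z ∈ Mω, ∃ x, SeqIn (M : Set (Op H)) x ∧ Bdd x ∧ limω x = z
  tr : ∀ x, SeqIn (M : Set (Op H)) x → Bdd x →
    Tendsto (fun n => τ (x n)) (ω : Filter ℕ) (nhds (τ (limω x)))
  eq_zero : ∀ x, SeqIn (M : Set (Op H)) x → Bdd x →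
    (limω x = 0 ↔ Tendsto (fun n => ‖τ (star (x n) * x n)‖) (ω : Filter ℕ) (nhds 0))
  traceState : IsTracialState (Mω : Set (Op H)) τ

/-- The ultrapower `N^ω ⊆ M^ω` of a subalgebra `N ⊆ M`: classes of bounded
sequences with entries in `N`. -/
def ultrapowerSet (limω : (ℕ → Op H) → Op H) (N : Set (Op H)) : Set (Op H) :=
  {z | ∃ x, SeqIn N x ∧ Bdd x ∧ limω x = z}

/-- `θ` is a *-homomorphism from `S` to `T` (as sets of operators). -/
def IsStarHomOn (θ : Op H → Op H) (S T : Set (Op H)) : Prop :=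
  (∀ x ∈ S, θ x ∈ T) ∧
  (∀ x ∈ S, ∀ y ∈ S, θ (x + y) = θ x + θ y) ∧
  (∀ x ∈ S, ∀ y ∈ S, θ (x * y) = θ x * θ y) ∧
  (∀ (c : ℂ), ∀ x ∈ S, θ (c • x) = c • θ x) ∧
  (∀ x ∈ S, θ (star x) = star (θ x))

/-- The corner `p S p` of a set of operators. -/
def corner (p : Op H) (S : Set (Op H)) : Set (Op H) :=
  {x | x ∈ S ∧ p * x * p = x}

/-- Popa's intertwining relation: a corner of `P` embeds into `Q` inside `M`,
written `P ≺_M Q`: there are nonzero projections `p ∈ P`, `q ∈ Q`, a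
*-homomorphism `θ : pPp → qQq` and a nonzero partial isometry `v ∈ qMp` with
`θ(x) v = v x` for all `x ∈ pPp`. -/
def CornerEmbeds (P Q M : Set (Op H)) : Prop :=
  ∃ (p q v : Op H) (θ : Op H → Op H),
    p ∈ P ∧ IsProjection p ∧ p ≠ 0 ∧
    q ∈ Q ∧ IsProjection q ∧ q ≠ 0 ∧
    IsStarHomOn θ (corner p P) (corner q Q) ∧
    v ∈ M ∧ v ≠ 0 ∧ IsProjection (star v * v) ∧ q * v * p = v ∧
    ∀ x ∈ corner p P, θ x * v = v * x

/-- `E` is the (`τ`-preserving) conditional expectation from `M` onto `Q`. -/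
structure IsCondExp (τ : Op H →ₗ[ℂ] ℂ) (M Q : Set (Op H)) (E : Op H → Op H) : Prop where
  mem : ∀ x ∈ M, E x ∈ Q
  fix : ∀ q ∈ Q, E q = q
  map_add : ∀ x ∈ M, ∀ y ∈ M, E (x + y) = E x + E y
  map_smul : ∀ (c : ℂ), ∀ x ∈ M, E (c • x) = c • E x
  bimod : ∀ a ∈ Q, ∀ x ∈ M, ∀ b ∈ Q, E (a * x * b) = a * E x * b
  tr : ∀ x ∈ M, τ (E x) = τ x

/-- `c` is a Pimsner–Popa bound for the inclusion `Q ⊆ M` with conditional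
expectation `E`: every positive `x ∈ M` satisfies `x ≤ c E(x)`. -/
def IndexBound (M : Set (Op H)) (E : Op H → Op H) (c : ℝ) : Prop :=
  ∀ x ∈ M, x.IsPositive → (c • E x - x).IsPositive

/-- The inclusion `Q ⊆ M` (with conditional expectation `E`) has finite Jones index. -/
def HasFiniteIndex (M : Set (Op H)) (E : Op H → Op H) : Prop :=
  ∃ c : ℝ, 0 < c ∧ IndexBound M E c

/-- The Jones index `[M : Q]` of an inclusion `Q ⊆ M` with conditional expectation `E`,
via the Pimsner–Popa characterization as the optimal constant `c` with
`x ≤ c E(x)` for all positive `x ∈ M`. -/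
noncomputable def jonesIndex (M : Set (Op H)) (E : Op H → Op H) : ℝ :=
  sInf {c : ℝ | 0 < c ∧ IndexBound M E c}

lemma vn_smul (M : VonNeumannAlgebra H) (c : ℂ) {x : Op H} (hx : x ∈ M) : c • x ∈ M :=
  M.toStarSubalgebra.smul_mem hx c

lemma vn_mem_of_comm (M : VonNeumannAlgebra H) {x : Op H}
    (h : ∀ m : Op H, (∀ g ∈ M, g * m = m * g) → m * x = x * m) : x ∈ M := by
  rw [← M.commutant_commutant, VonNeumannAlgebra.mem_commutant_iff]
  intro g hg
  exact h g (VonNeumannAlgebra.mem_commutant_iff.1 hg)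

lemma vn_sqrt (M : VonNeumannAlgebra H) {x : Op H} (hx : x ∈ M) (h0 : 0 ≤ x) :
    ∃ s ∈ M, star s = s ∧ s * s = x := by
  refine ⟨CFC.sqrt x, ?_, (CFC.sqrt_nonneg x).isSelfAdjoint.star_eq, CFC.sqrt_mul_sqrt_self x h0⟩
  apply vn_mem_of_comm
  intro m hm
  have h1 : Commute x m := hm x hx
  exact (h1.cfcₙ_nnreal NNReal.sqrt).symm.eq

lemma tr_nonneg {M : VonNeumannAlgebra H} {τ : Op H →ₗ[ℂ] ℂ}
    (hτ : IsTracialState (M : Set (Op H)) τ) {x : Op H} (hx : x ∈ M) (h0 : 0 ≤ x) : 0 ≤ τ x := by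
  obtain ⟨s, hs, h1, h2⟩ := vn_sqrt M hx h0
  have := hτ.pos s hs
  rwa [h1, h2] at this

/-- squared two-norm -/
noncomputable def q (τ : Op H →ₗ[ℂ] ℂ) (x : Op H) : ℝ := (τ (star x * x)).re

section
variable {M : VonNeumannAlgebra H} {τ : Op H →ₗ[ℂ] ℂ}

lemma q_nonneg (hτ : IsTracialState (M : Set (Op H)) τ) {x : Op H} (hx : x ∈ M) : 0 ≤ q τ x :=
  (Complex.nonneg_iff.1 (hτ.pos x hx)).1

lemma q_coe (hτ : IsTracialState (M : Set (Op H)) τ) {x : Op H} (hx : x ∈ M) :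
    τ (star x * x) = (q τ x : ℂ) := by
  apply Complex.ext
  · simp [q]
  · simpa using (Complex.nonneg_iff.1 (hτ.pos x hx)).2.symm

lemma q_norm (hτ : IsTracialState (M : Set (Op H)) τ) {x : Op H} (hx : x ∈ M) :
    ‖τ (star x * x)‖ = q τ x := by
  rw [q_coe hτ hx, Complex.norm_real, Real.norm_of_nonneg (q_nonneg hτ hx)]

lemma q_star (hτ : IsTracialState (M : Set (Op H)) τ) {x : Op H} (hx : x ∈ M) :
    q τ (star x) = q τ x := by
  unfold q
  rw [star_star, hτ.tracial x hx (star x) (star_mem hx)]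

lemma tr_re_mono (hτ : IsTracialState (M : Set (Op H)) τ) {x y : Op H} (hx : x ∈ M) (hy : y ∈ M)
    (h : x ≤ y) : (τ x).re ≤ (τ y).re := by
  have := tr_nonneg hτ (sub_mem hy hx) (sub_nonneg.2 h)
  have := (Complex.nonneg_iff.1 this).1
  simp at this
  linarith

lemma q_mul_left (hτ : IsTracialState (M : Set (Op H)) τ) {e x : Op H} (he : e ∈ M) (hx : x ∈ M) :
    q τ (e * x) ≤ ‖e‖ ^ 2 * q τ x := by
  have h1 : star e * e ≤ algebraMap ℝ (Op H) (‖e‖ ^ 2) := CStarAlgebra.star_mul_le_algebraMap_norm_sq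
  have h2 := star_left_conjugate_le_conjugate h1 x
  have h3 : star x * algebraMap ℝ (Op H) (‖e‖ ^ 2) * x = ((‖e‖ ^ 2 : ℝ) : ℂ) • (star x * x) := by
    ext v
    simp only [Algebra.algebraMap_eq_smul_one]
    rw [Complex.coe_smul]
    simp
  rw [h3] at h2
  have h4 := tr_re_mono hτ (mul_mem (mul_mem (star_mem hx) (mul_mem (star_mem he) he)) hx)
    (vn_smul M _ (mul_mem (star_mem hx) hx)) h2
  rw [map_smul, smul_eq_mul, Complex.re_ofReal_mul] at h4
  simpa [q, mul_assoc] using h4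

lemma q_mul_right (hτ : IsTracialState (M : Set (Op H)) τ) {e x : Op H} (he : e ∈ M) (hx : x ∈ M) :
    q τ (x * e) ≤ ‖e‖ ^ 2 * q τ x := by
  have := q_mul_left hτ (star_mem he) (star_mem hx)
  rwa [← star_mul, q_star hτ (mul_mem hx he), q_star hτ hx, norm_star] at this

lemma q_one (hτ : IsTracialState (M : Set (Op H)) τ) : q τ 1 = 1 := by
  simp [q, hτ.map_one]

lemma q_le (hτ : IsTracialState (M : Set (Op H)) τ) {x : Op H} (hx : x ∈ M) :
    q τ x ≤ ‖x‖ ^ 2 := by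
  have := q_mul_left hτ hx (one_mem M)
  rwa [mul_one, q_one hτ, mul_one] at this

lemma q_par (x y : Op H) : q τ (x + y) + q τ (x - y) = 2 * q τ x + 2 * q τ y := by
  simp only [q, ← Complex.add_re, ← map_add]
  have : star (x + y) * (x + y) + star (x - y) * (x - y)
      = (star x * x + star x * x) + (star y * y + star y * y) := by
    simp only [star_add, star_sub]; noncomm_ring
  rw [this]; simp only [map_add, Complex.add_re]; ring

lemma q_smul (c : ℝ) (x : Op H) : q τ ((c : ℂ) • x) = c ^ 2 * q τ x := by
  simp only [q, star_smul, smul_mul_assoc, mul_smul_comm, map_smul, smul_eq_mul]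
  simp only [Complex.star_def, Complex.conj_ofReal, Complex.re_ofReal_mul]; ring
end

section
variable {ω : Ultrafilter ℕ} {M Mω : VonNeumannAlgebra H} {τ : Op H →ₗ[ℂ] ℂ}
  {limω : (ℕ → Op H) → Op H}

lemma Bdd.sub {x y : ℕ → Op H} (hx : Bdd x) (hy : Bdd y) : Bdd (fun n => x n - y n) := by
  obtain ⟨C, hC⟩ := hx; obtain ⟨D, hD⟩ := hy
  exact ⟨C + D, fun n => (norm_sub_le _ _).trans (add_le_add (hC n) (hD n))⟩

lemma Bdd.mul {x y : ℕ → Op H} (hx : Bdd x) (hy : Bdd y) : Bdd (fun n => x n * y n) := by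
  obtain ⟨C, hC⟩ := hx; obtain ⟨D, hD⟩ := hy
  exact ⟨C * D, fun n => (norm_mul_le _ _).trans (mul_le_mul (hC n) (hD n) (norm_nonneg _)
    ((norm_nonneg _).trans (hC n)))⟩

lemma Bdd.star {x : ℕ → Op H} (hx : Bdd x) : Bdd (fun n => star (x n)) := by
  obtain ⟨C, hC⟩ := hx
  exact ⟨C, fun n => by rw [norm_star]; exact hC n⟩

lemma Bdd.const (a : Op H) : Bdd (fun _ => a) := ⟨‖a‖, fun _ => le_rfl⟩

lemma lim_sub (hU : IsTracialUltrapower ω M Mω τ limω) {x y : ℕ → Op H}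
    (hx : SeqIn (M : Set (Op H)) x) (bx : Bdd x) (hy : SeqIn (M : Set (Op H)) y) (bY : Bdd y) :
    limω (fun n => x n - y n) = limω x - limω y := by
  have h1 := hU.map_smul (-1) y hy bY
  have bz : Bdd (fun n => (-1 : ℂ) • y n) := by
    obtain ⟨D, hD⟩ := bY
    exact ⟨D, fun n => by simpa using hD n⟩
  have h2 := hU.map_add x (fun n => (-1 : ℂ) • y n) hx bx (fun n => vn_smul M _ (hy n)) bz
  rw [h1] at h2
  simpa [sub_eq_add_neg] using h2

lemma lim_eq_zero (hU : IsTracialUltrapower ω M Mω τ limω)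
    (hτ : IsTracialState (M : Set (Op H)) τ) {x : ℕ → Op H}
    (hx : SeqIn (M : Set (Op H)) x) (bx : Bdd x) :
    limω x = 0 ↔ Tendsto (fun n => q τ (x n)) (ω : Filter ℕ) (nhds 0) := by
  rw [hU.eq_zero x hx bx]
  have : (fun n => ‖τ (star (x n) * x n)‖) = fun n => q τ (x n) :=
    funext fun n => q_norm hτ (hx n)
  rw [this]

lemma lim_congr (hU : IsTracialUltrapower ω M Mω τ limω)
    (hτ : IsTracialState (M : Set (Op H)) τ) {x y : ℕ → Op H}
    (hx : SeqIn (M : Set (Op H)) x) (bx : Bdd x) (hy : SeqIn (M : Set (Op H)) y) (bY : Bdd y)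
    (h : ∀ᶠ n in (ω : Filter ℕ), x n = y n) : limω x = limω y := by
  rw [← sub_eq_zero, ← lim_sub hU hx bx hy bY,
    lim_eq_zero hU hτ (fun n => sub_mem (hx n) (hy n)) (bx.sub bY)]
  apply tendsto_const_nhds.congr'
  filter_upwards [h] with n hn
  simp [hn, q]

lemma lim_norm_le (hU : IsTracialUltrapower ω M Mω τ limω)
    {x : ℕ → Op H} (hx : SeqIn (M : Set (Op H)) x) {C : ℝ} (hC : ∀ n, ‖x n‖ ≤ C) :
    ‖limω x‖ ≤ C := by
  have hC0 : 0 ≤ C := (norm_nonneg _).trans (hC 0)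
  have bx : Bdd x := ⟨C, hC⟩
  have key : ∀ n, ∃ s ∈ M, star s = s ∧ s * s = ((C ^ 2 : ℝ) : ℂ) • (1 : Op H) - star (x n) * x n := by
    intro n
    apply vn_sqrt M (sub_mem (vn_smul M _ (one_mem M)) (mul_mem (star_mem (hx n)) (hx n)))
    rw [sub_nonneg]
    have h1 : star (x n) * x n ≤ algebraMap ℝ (Op H) (‖x n‖ ^ 2) :=
      CStarAlgebra.star_mul_le_algebraMap_norm_sq
    refine h1.trans ?_
    have h2 : algebraMap ℝ (Op H) (‖x n‖ ^ 2) ≤ algebraMap ℝ (Op H) (C ^ 2) :=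
      algebraMap_mono _ (by have := hC n; gcongr)
    convert h2 using 1
    rw [Algebra.algebraMap_eq_smul_one, Complex.coe_smul]
  choose s hs hs1 hs2 using key
  have bs : Bdd s := by
    refine ⟨C ^ 2 + C ^ 2 + 1, fun n => ?_⟩
    have h1 : ‖s n‖ * ‖s n‖ ≤ C ^ 2 + C ^ 2 := by
      rw [← CStarRing.norm_star_mul_self, hs1, hs2]
      refine (norm_sub_le _ _).trans (add_le_add ?_ ?_)
      · rw [norm_smul]
        have : ‖(1 : Op H)‖ ≤ 1 := ContinuousLinearMap.norm_id_le
        rw [Complex.norm_real, Real.norm_of_nonneg (by positivity)]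
        nlinarith [sq_nonneg C]
      · rw [CStarRing.norm_star_mul_self]; nlinarith [hC n, norm_nonneg (x n)]
    by_contra hcon
    push Not at hcon
    nlinarith [sq_nonneg C, norm_nonneg (s n)]
  have e1 : limω (fun n => s n * s n) = ((C ^ 2 : ℝ) : ℂ) • (1 : Op H) - star (limω x) * limω x := by
    have : (fun n => s n * s n) = fun n => (fun _ => ((C ^ 2 : ℝ) : ℂ) • (1 : Op H)) n
        - (fun n => star (x n) * x n) n := funext hs2
    rw [this, lim_sub hU (fun n => vn_smul M _ (one_mem M)) (Bdd.const _)
      (fun n => mul_mem (star_mem (hx n)) (hx n)) (bx.star.mul bx),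
      hU.diag _ (vn_smul M _ (one_mem M)),
      hU.map_mul _ _ (fun n => star_mem (hx n)) bx.star hx bx, hU.map_star x hx bx]
  have e2 : star (limω s) = limω s := by
    rw [← hU.map_star s hs bs]; simp only [hs1]
  rw [hU.map_mul s s hs bs hs bs] at e1
  refine ContinuousLinearMap.opNorm_le_bound _ hC0 fun v => ?_
  have e3 : star (limω x) * limω x + star (limω s) * limω s = ((C ^ 2 : ℝ) : ℂ) • (1 : Op H) := by
    rw [e2, e1]; abel
  have e4 := congrArg (fun T : Op H => RCLike.re (inner ℂ (T v) v)) e3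
  have f1 := ContinuousLinearMap.apply_norm_sq_eq_inner_adjoint_left (limω x) v
  have f2 := ContinuousLinearMap.apply_norm_sq_eq_inner_adjoint_left (limω s) v
  simp only [add_apply, inner_add_left, map_add] at e4
  have f3 : RCLike.re (inner ℂ ((((C ^ 2 : ℝ) : ℂ) • (1 : Op H)) v) v) = C ^ 2 * ‖v‖ ^ 2 := by
    rw [Complex.coe_smul]
    simp [inner_self_eq_norm_sq_to_K]
    norm_cast
    ring
  rw [f3] at e4
  have f4 : ‖limω x v‖ ^ 2 + ‖limω s v‖ ^ 2 = C ^ 2 * ‖v‖ ^ 2 := by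
    rw [f1, f2]; exact e4
  apply le_of_sq_le_sq _ (by positivity)
  nlinarith [sq_nonneg ‖limω s v‖]
end

section
variable {ω : Ultrafilter ℕ} {M Mω : VonNeumannAlgebra H} {τ : Op H →ₗ[ℂ] ℂ}
  {limω : (ℕ → Op H) → Op H}

lemma exists_resolvent (hτ : IsTracialState (M : Set (Op H)) τ)
    (y : ℕ → Op H) (hy : ∀ i, y i ∈ M) (k : ℕ) :
    ∃ p r : Op H, p ∈ M ∧ r ∈ M ∧ star r = r ∧ 0 ≤ p ∧ r * p = 1 ∧ p * r = 1 ∧ ‖p‖ ≤ 1 ∧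
      (∀ j ≤ k, ‖y j * p‖ ≤ (1 / 2) ^ j) ∧
      ∀ e ∈ M, (τ (star e * r * e)).re
        ≤ ‖e‖ ^ 2 * (1 + ∑ i ∈ Finset.range (k + 1), 4 ^ i * q τ (y i)) := by
  set r : Op H := 1 + ∑ i ∈ Finset.range (k + 1), ((4 ^ i : ℝ) : ℂ) • (star (y i) * y i) with hr
  have hrM : r ∈ M := add_mem (one_mem M) (sum_mem fun i _ =>
    vn_smul M _ (mul_mem (star_mem (hy i)) (hy i)))
  have hr1 : (1 : Op H) ≤ r := by
    rw [hr]
    refine le_add_of_nonneg_right (Finset.sum_nonneg fun i _ => ?_)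
    rw [Complex.coe_smul]
    exact smul_nonneg (by positivity) (star_mul_self_nonneg _)
  have hr0 : (0 : Op H) ≤ r := zero_le_one.trans hr1
  have hrs : star r = r := hr0.isSelfAdjoint.star_eq
  obtain ⟨u, hu⟩ : IsUnit r := CStarAlgebra.isUnit_of_le 1 hr1
  set p : Op H := ↑u⁻¹ with hp
  have h1 : r * p = 1 := by rw [← hu, hp]; simp
  have h2 : p * r = 1 := by rw [← hu, hp]; simp
  have hpM : p ∈ M := by
    apply vn_mem_of_comm
    intro m hm
    have := hm r hrM
    calc m * p = p * (r * m) * p := by rw [← mul_assoc, h2, one_mul]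
      _ = p * m * (r * p) := by rw [this]; noncomm_ring
      _ = p * m := by rw [h1, mul_one]
  have hps : star p = p := by
    calc star p = star p * (r * p) := by rw [h1, mul_one]
      _ = star (r * p) * p := by rw [star_mul, hrs, mul_assoc]
      _ = p := by rw [h1]; simp
  have hp0 : 0 ≤ p := by
    have := star_left_conjugate_nonneg hr0 p
    rwa [hps, h2, one_mul] at this
  have key : ∀ v : H, ‖v‖ ^ 2 + ∑ i ∈ Finset.range (k + 1), 4 ^ i * ‖y i v‖ ^ 2
      = RCLike.re (inner ℂ (r v) v) := by
    intro v
    have f : ∀ i, ‖y i v‖ ^ 2 = RCLike.re (inner ℂ ((star (y i) * y i) v) v) := fun i =>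
      ContinuousLinearMap.apply_norm_sq_eq_inner_adjoint_left (y i) v
    rw [hr]
    simp only [add_apply, inner_add_left, map_add, sum_apply, sum_inner, map_sum, f]
    congr 1
    · simp [inner_self_eq_norm_sq_to_K]; norm_cast
    · refine Finset.sum_congr rfl fun i _ => ?_
      rw [smul_apply, inner_smul_left, Complex.conj_ofReal]
      exact (Complex.re_ofReal_mul _ _).symm
  have key2 : ∀ w : H, ‖p w‖ ^ 2 + ∑ i ∈ Finset.range (k + 1), 4 ^ i * ‖y i (p w)‖ ^ 2
      ≤ ‖w‖ * ‖p w‖ := by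
    intro w
    rw [key]
    have : r (p w) = w := congrArg (fun T : Op H => T w) h1
    rw [this]
    exact re_inner_le_norm _ _
  have key3 : ∀ w : H, ‖p w‖ ≤ ‖w‖ := by
    intro w
    have h := key2 w
    have : 0 ≤ ∑ i ∈ Finset.range (k + 1), 4 ^ i * ‖y i (p w)‖ ^ 2 := by positivity
    by_contra hc
    push Not at hc
    nlinarith [norm_nonneg w, norm_nonneg (p w)]
  refine ⟨p, r, hpM, hrM, hrs, hp0, h1, h2, ?_, ?_, ?_⟩
  · exact ContinuousLinearMap.opNorm_le_bound _ zero_le_one fun w => by simpa using key3 w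
  · intro j hj
    refine ContinuousLinearMap.opNorm_le_bound _ (by positivity) fun w => ?_
    have h := key2 w
    have h4 : 4 ^ j * ‖y j (p w)‖ ^ 2 ≤ ∑ i ∈ Finset.range (k + 1), 4 ^ i * ‖y i (p w)‖ ^ 2 :=
      Finset.single_le_sum (f := fun i => (4 : ℝ) ^ i * ‖y i (p w)‖ ^ 2)
        (fun i _ => by positivity) (Finset.mem_range.2 (by omega))
    have h5 : (2 ^ j * ‖y j (p w)‖) ^ 2 ≤ ‖w‖ ^ 2 := by
      have : (2 ^ j * ‖y j (p w)‖) ^ 2 = 4 ^ j * ‖y j (p w)‖ ^ 2 := by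
        rw [mul_pow, ← pow_mul, mul_comm j 2, pow_mul]; norm_num
      rw [this]
      nlinarith [key3 w, norm_nonneg w, sq_nonneg ‖p w‖]
    have h6 := le_of_sq_le_sq h5 (norm_nonneg w)
    change ‖y j (p w)‖ ≤ _
    rw [one_div, inv_pow, ← div_eq_inv_mul, le_div_iff₀ (by positivity), mul_comm]
    exact h6
  · intro e he
    have : star e * r * e = star e * e + ∑ i ∈ Finset.range (k + 1),
        ((4 ^ i : ℝ) : ℂ) • (star (y i * e) * (y i * e)) := by
      rw [hr]
      simp only [mul_add, add_mul, mul_one, Finset.mul_sum, Finset.sum_mul, mul_smul_comm,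
        smul_mul_assoc, star_mul, mul_assoc]
    rw [this, map_add, map_sum, Complex.add_re, Complex.re_sum, mul_add, Finset.mul_sum, mul_one]
    refine add_le_add (q_le hτ he) (Finset.sum_le_sum fun i _ => ?_)
    rw [map_smul, smul_eq_mul, Complex.re_ofReal_mul]
    have := q_mul_right hτ he (hy i)
    calc (4 : ℝ) ^ i * (τ (star (y i * e) * (y i * e))).re ≤ 4 ^ i * (‖e‖ ^ 2 * q τ (y i)) := by
          gcongr; exact this
      _ = _ := by ring

lemma rapid (hU : IsTracialUltrapower ω M Mω τ limω)
    (hτ : IsTracialState (M : Set (Op H)) τ)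
    (y : ℕ → Op H) (hy : ∀ i, y i ∈ M) (B : ℝ)
    (hB : ∀ k, ∑ i ∈ Finset.range (k + 1), 4 ^ i * q τ (y i) ≤ B) :
    ∃ p : ℕ → Op H, SeqIn (M : Set (Op H)) p ∧ (∀ k, ‖p k‖ ≤ 1) ∧
      (∀ k, ∀ j ≤ k, ‖y j * p k‖ ≤ (1 / 2) ^ j) ∧ DenseRange (limω p) := by
  choose p r hp hr hrs hp0 h1 h2 h3 h4 h5 using exists_resolvent hτ y hy
  have bp : Bdd p := ⟨1, h3⟩
  refine ⟨p, hp, h3, h4, ?_⟩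
  set a := limω p with ha
  have haM : a ∈ Mω := hU.mem p hp bp
  have has : star a = a := by
    rw [ha, ← hU.map_star p hp bp]
    simp only [(hp0 _).isSelfAdjoint.star_eq]
  set K : Submodule ℂ H := LinearMap.ker (a : H →ₗ[ℂ] H) with hK
  have hKc : IsClosed (K : Set H) := a.isClosed_ker
  have : CompleteSpace K := hKc.completeSpace_coe
  set e : Op H := K.starProjection with he
  have heP : IsStarProjection e := isStarProjection_starProjection
  have heM : e ∈ Mω := by
    rw [VonNeumannAlgebra.IsStarProjection.mem_iff heP]
    intro m hm
    rw [VonNeumannAlgebra.mem_commutant_iff] at hm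
    have : e.range = K := Submodule.range_starProjection K
    rw [this]
    intro v hv
    have hv : a v = 0 := hv
    change a (m v) = 0
    have := congrArg (fun T : Op H => T v) (hm a haM)
    simpa [hv] using this
  obtain ⟨f, hf, bf, hfe⟩ := hU.surj e heM
  have hae : a * e = 0 := by
    ext v
    exact (Submodule.starProjection_apply_mem K v : _)
  obtain ⟨C, hC⟩ := bf
  have bf : Bdd f := ⟨C, hC⟩
  have t1 : Tendsto (fun k => (τ (star (f k) * (p k * f k))).re) ω (nhds 0) := by
    have := hU.tr (fun k => star (f k) * (p k * f k))
      (fun k => mul_mem (star_mem (hf k)) (mul_mem (hp k) (hf k))) (bf.star.mul (bp.mul bf))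
    rw [hU.map_mul _ _ (fun k => star_mem (hf k)) bf.star (fun k => mul_mem (hp k) (hf k))
      (bp.mul bf), hU.map_mul p f hp bp hf bf, hfe, ← ha, hae, mul_zero, map_zero] at this
    have h := (Complex.continuous_re.tendsto _).comp this
    rw [Complex.zero_re] at h
    exact h
  set D := C ^ 2 * (1 + max B 0) with hD
  have hC0 : 0 ≤ C := (norm_nonneg _).trans (hC 0)
  have main : ∀ t : ℝ, 0 < t → ∀ k, 2 * q τ (f k) ≤
      t * (τ (star (f k) * (p k * f k))).re + D / t := by
    intro t ht k
    have e1 : 0 ≤ τ (star ((t : ℂ) • f k - r k * f k) * p k * ((t : ℂ) • f k - r k * f k)) := by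
      apply tr_nonneg hτ
      · have : (t : ℂ) • f k - r k * f k ∈ M := sub_mem (vn_smul M _ (hf k)) (mul_mem (hr k) (hf k))
        exact mul_mem (mul_mem (star_mem this) (hp k)) this
      · exact star_left_conjugate_nonneg (hp0 k) _
    have e2 : star ((t : ℂ) • f k - r k * f k) * p k * ((t : ℂ) • f k - r k * f k)
        = ((t ^ 2 : ℝ) : ℂ) • (star (f k) * (p k * f k)) - ((2 * t : ℝ) : ℂ) • (star (f k) * f k)
          + star (f k) * r k * f k := by
      have g1 : p k * (r k * f k) = f k := by rw [← mul_assoc, h2, one_mul]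
      have g2 : r k * (p k * f k) = f k := by rw [← mul_assoc, h1, one_mul]
      simp only [star_sub, star_smul, star_mul, hrs, Complex.star_def, Complex.conj_ofReal,
        sub_mul, mul_sub, smul_mul_assoc, mul_smul_comm, mul_assoc, g1, g2, smul_sub, smul_smul]
      push_cast
      module
    rw [e2] at e1
    have e3 := (Complex.nonneg_iff.1 e1).1
    rw [map_add, map_sub, map_smul, map_smul, smul_eq_mul, smul_eq_mul, Complex.add_re,
      Complex.sub_re, Complex.re_ofReal_mul, Complex.re_ofReal_mul] at e3
    have e4 := h5 k (f k) (hf k)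
    have e5 : ‖f k‖ ^ 2 * (1 + ∑ i ∈ Finset.range (k + 1), 4 ^ i * q τ (y i)) ≤ D := by
      have g0 : 0 ≤ ∑ i ∈ Finset.range (k + 1), 4 ^ i * q τ (y i) :=
        Finset.sum_nonneg fun i _ => mul_nonneg (by positivity) (q_nonneg hτ (hy i))
      have g1 := hC k
      have g2 := (hB k).trans (le_max_left B 0)
      rw [hD]
      gcongr
    have e6 : 2 * q τ (f k) * t ≤ t ^ 2 * (τ (star (f k) * (p k * f k))).re + D := by
      unfold q; linarith
    rw [← sub_nonneg] at e6 ⊢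
    have : t * (τ (star (f k) * (p k * f k))).re + D / t - 2 * q τ (f k) =
      (t ^ 2 * (τ (star (f k) * (p k * f k))).re + D - 2 * q τ (f k) * t) / t := by
      field_simp
    rw [this]
    positivity
  have hq0 : Tendsto (fun k => q τ (f k)) ω (nhds 0) := by
    rw [Metric.tendsto_nhds]
    intro ε hε
    have hD0 : 0 ≤ D := by positivity
    set t := D / ε + 1 with ht
    have ht0 : 0 < t := by positivity
    have hDt : D / t ≤ ε := by
      rw [div_le_iff₀ ht0, ht, mul_add, mul_div_cancel₀ _ hε.ne']
      linarith
    have := (Metric.tendsto_nhds.1 t1) (ε / t) (by positivity)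
    filter_upwards [this] with k hk
    have m := main t ht0 k
    have q0 := q_nonneg hτ (hf k)
    rw [Real.dist_eq, sub_zero] at hk ⊢
    rw [abs_of_nonneg q0]
    have : t * (τ (star (f k) * (p k * f k))).re < ε := by
      have := (le_abs_self _).trans_lt hk
      rwa [lt_div_iff₀ ht0, mul_comm] at this
    linarith
  have he0 : e = 0 := by
    rw [← hfe]; exact (lim_eq_zero hU hτ hf bf).2 hq0
  have hKbot : K = ⊥ := by
    rw [eq_bot_iff]
    intro v hv
    have : e v = v := Submodule.starProjection_eq_self_iff.2 hv
    rw [he0] at this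
    simpa using this.symm
  have hr : (a.range)ᗮ = ⊥ := by
    rw [ContinuousLinearMap.orthogonal_range]
    have : ContinuousLinearMap.adjoint a = a := has
    rw [this]; exact hKbot
  rw [← Submodule.topologicalClosure_eq_top_iff, ← Submodule.dense_iff_topologicalClosure_eq_top] at hr
  exact hr
end

section
variable {ω : Ultrafilter ℕ} {M Mω : VonNeumannAlgebra H} {τ : Op H →ₗ[ℂ] ℂ}
  {limω : (ℕ → Op H) → Op H}

lemma strong_of_dense (T : ℕ → Op H) (C : ℝ) (hC : ∀ j, ‖T j‖ ≤ C) (a : Op H)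
    (ha : DenseRange a) (h : Tendsto (fun j => ‖T j * a‖) atTop (nhds 0)) (v : H) :
    Tendsto (fun j => ‖T j v‖) atTop (nhds 0) := by
  rw [Metric.tendsto_atTop]
  intro ε hε
  have hC0 : 0 ≤ C := (norm_nonneg _).trans (hC 0)
  obtain ⟨w, hw⟩ := ha.exists_dist_lt v (ε := ε / (2 * (C + 1))) (by positivity)
  obtain ⟨J, hJ⟩ := (Metric.tendsto_atTop.1 h) (ε / (2 * (‖w‖ + 1))) (by positivity)
  refine ⟨J, fun j hj => ?_⟩
  have h1 := hJ j hj
  rw [Real.dist_eq, sub_zero, abs_of_nonneg (norm_nonneg _)] at h1 ⊢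
  have h2 : ‖T j v‖ ≤ ‖T j (v - a w)‖ + ‖(T j * a) w‖ := by
    have : T j v = T j (v - a w) + (T j * a) w := by simp
    rw [this]; exact norm_add_le _ _
  have h3 : ‖T j (v - a w)‖ ≤ C * (ε / (2 * (C + 1))) := by
    refine (ContinuousLinearMap.le_opNorm _ _).trans ?_
    rw [dist_eq_norm] at hw
    exact mul_le_mul (hC j) hw.le (norm_nonneg _) hC0
  have h4 : ‖(T j * a) w‖ ≤ (ε / (2 * (‖w‖ + 1))) * ‖w‖ :=
    (ContinuousLinearMap.le_opNorm _ _).trans (by gcongr)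
  have h5 : C * (ε / (2 * (C + 1))) < ε / 2 := by
    rw [← mul_div_assoc, div_lt_div_iff₀ (by positivity) (by positivity)]; nlinarith
  have h6 : (ε / (2 * (‖w‖ + 1))) * ‖w‖ ≤ ε / 2 := by
    rw [div_mul_eq_mul_div, div_le_div_iff₀ (by positivity) (by positivity)]
    nlinarith [norm_nonneg w]
  linarith

lemma free_ge (hω : IsFreeUltrafilter ω) (j : ℕ) : ∀ᶠ k in (ω : Filter ℕ), j ≤ k := by
  have := hω (Set.Iio j) (Set.finite_Iio j)
  rw [← Ultrafilter.compl_mem_iff_notMem] at this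
  filter_upwards [this] with k hk
  simpa using hk

lemma lim_norm_le_tail (hω : IsFreeUltrafilter ω) (hU : IsTracialUltrapower ω M Mω τ limω)
    (hτ : IsTracialState (M : Set (Op H)) τ)
    {x : ℕ → Op H} (hx : SeqIn (M : Set (Op H)) x) (bx : Bdd x) {C : ℝ} (j : ℕ)
    (hC : ∀ k, j ≤ k → ‖x k‖ ≤ C) :
    ‖limω x‖ ≤ C := by
  have h1 : ∀ k, ‖x (max j k)‖ ≤ C := fun k => hC _ (le_max_left _ _)
  have := lim_norm_le hU (x := fun k => x (max j k)) (fun k => hx _) h1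
  rwa [← lim_congr hU hτ hx bx (fun k => hx _) ⟨C, h1⟩] at this
  filter_upwards [free_ge hω j] with k hk
  simp [hk]

lemma geom_bound (k : ℕ) : ∑ i ∈ Finset.range k, ((1 / 2 : ℝ)) ^ i ≤ 2 := by
  have := Summable.sum_le_tsum (Finset.range k) (f := fun i => (1 / 2 : ℝ) ^ i)
    (fun i _ => by positivity) summable_geometric_two
  rwa [tsum_geometric_two] at this

lemma strong_zero (hω : IsFreeUltrafilter ω) (hU : IsTracialUltrapower ω M Mω τ limω)
    (hτ : IsTracialState (M : Set (Op H)) τ)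
    {d : ℕ → Op H} (hd : SeqIn (M : Set (Op H)) d) (bd : Bdd d)
    (h : Tendsto (fun n => q τ (d n)) ω (nhds 0)) (v : H) :
    Tendsto (fun n => ‖d n v‖) ω (nhds 0) := by
  by_contra hc
  rw [Metric.tendsto_nhds] at hc
  push Not at hc
  obtain ⟨δ, hδ, hf⟩ := hc
  have hf : ∀ᶠ n in (ω : Filter ℕ), δ ≤ dist ‖d n v‖ 0 := hf
  have : ∀ j : ℕ, ∃ n, δ ≤ ‖d n v‖ ∧ q τ (d n) ≤ (1 / 8) ^ j := by
    intro j
    have h1 := h.eventually (gt_mem_nhds (show (0 : ℝ) < (1 / 8) ^ j by positivity))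
    obtain ⟨n, hn1, hn2⟩ := (hf.and h1).exists
    refine ⟨n, ?_, hn2.le⟩
    simpa using hn1
  choose n hn1 hn2 using this
  obtain ⟨C, hC⟩ := bd
  obtain ⟨p, hp, hp1, hp2, hp3⟩ := rapid hU hτ (fun j => d (n j)) (fun j => hd _) 2 (by
    intro k
    refine le_trans (Finset.sum_le_sum fun i _ => ?_) (geom_bound (k + 1))
    calc (4 : ℝ) ^ i * q τ (d (n i)) ≤ 4 ^ i * (1 / 8) ^ i := by gcongr; exact hn2 i
      _ = (1 / 2) ^ i := by rw [← mul_pow]; norm_num)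
  have bp : Bdd p := ⟨1, hp1⟩
  have key : ∀ j, ‖d (n j) * limω p‖ ≤ (1 / 2) ^ j := by
    intro j
    have e := hU.map_mul (fun _ => d (n j)) p (fun _ => hd _) (Bdd.const _) hp bp
    rw [hU.diag _ (hd _)] at e
    rw [← e]
    exact lim_norm_le_tail hω hU hτ (fun k => mul_mem (hd _) (hp k)) ((Bdd.const _).mul bp) j
      (fun k hk => hp2 k j hk)
  have t := strong_of_dense (fun j => d (n j)) C (fun j => hC _) (limω p) hp3
    (squeeze_zero (fun _ => norm_nonneg _) key
      (tendsto_pow_atTop_nhds_zero_of_lt_one (by norm_num) (by norm_num))) v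
  have := ge_of_tendsto' t hn1
  linarith

/-- Rapidly `q`-Cauchy sequences converge strongly, to their ultralimit. -/
lemma strong_cauchy (hω : IsFreeUltrafilter ω) (hU : IsTracialUltrapower ω M Mω τ limω)
    (hτ : IsTracialState (M : Set (Op H)) τ)
    {x : ℕ → Op H} (hx : SeqIn (M : Set (Op H)) x) (bx : Bdd x)
    (h : ∀ j, q τ (x (j + 1) - x j) ≤ (1 / 8) ^ j) : limω x ∈ M := by
  obtain ⟨C, hC⟩ := bx
  have bx : Bdd x := ⟨C, hC⟩
  obtain ⟨p, hp, hp1, hp2, hp3⟩ := rapid hU hτ (fun j => x (j + 1) - x j)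
    (fun j => sub_mem (hx _) (hx _)) 2 (by
    intro k
    refine le_trans (Finset.sum_le_sum fun i _ => ?_) (geom_bound (k + 1))
    calc (4 : ℝ) ^ i * q τ (x (i + 1) - x i) ≤ 4 ^ i * (1 / 8) ^ i := by gcongr; exact h i
      _ = (1 / 2) ^ i := by rw [← mul_pow]; norm_num)
  have bp : Bdd p := ⟨1, hp1⟩
  set z := limω x with hz
  have tele : ∀ j m k, j + m ≤ k → ‖(x (j + m) - x j) * p k‖ ≤ 2 * (1 / 2) ^ j - 2 * (1 / 2) ^ (j + m) := by
    intro j m k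
    induction m with
    | zero => intro _; simp
    | succ m ih =>
      intro hk
      have h1 := ih (by omega)
      have h2 := hp2 k (j + m) (by omega)
      have : (x (j + (m + 1)) - x j) * p k =
        (x (j + m + 1) - x (j + m)) * p k + (x (j + m) - x j) * p k := by
        rw [← add_mul, ← add_assoc]; congr 1; abel
      rw [this]
      refine (norm_add_le _ _).trans ?_
      rw [← add_assoc, pow_succ]
      linarith
  have key : ∀ j, ‖(x j - z) * limω p‖ ≤ 2 * (1 / 2) ^ j := by
    intro j
    have e1 := lim_sub hU hx bx (fun _ => hx j) (Bdd.const (x j))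
    rw [hU.diag _ (hx j)] at e1
    have e := hU.map_mul (fun k => x k - x j) p (fun k => sub_mem (hx _) (hx _))
      (bx.sub (Bdd.const _)) hp bp
    rw [e1] at e
    have : (x j - z) * limω p = - ((z - x j) * limω p) := by noncomm_ring
    rw [this, norm_neg, ← e]
    refine lim_norm_le_tail hω hU hτ (fun k => mul_mem (sub_mem (hx _) (hx _)) (hp k))
      ((bx.sub (Bdd.const _)).mul bp) j (fun k hk => ?_)
    obtain ⟨m, rfl⟩ := Nat.exists_eq_add_of_le hk
    have := tele j m (j + m) le_rfl
    have h0 : (0 : ℝ) ≤ 2 * (1 / 2) ^ (j + m) := by positivity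
    linarith
  have t := strong_of_dense (fun j => x j - z) (C + ‖z‖)
    (fun j => (norm_sub_le _ _).trans (by gcongr; exact hC j)) (limω p) hp3
    (squeeze_zero (fun _ => norm_nonneg _) key (by
      have := (tendsto_pow_atTop_nhds_zero_of_lt_one (r := (1 / 2 : ℝ)) (by norm_num)
        (by norm_num)).const_mul 2
      simpa using this))
  have conv : ∀ v, Tendsto (fun j => x j v) atTop (nhds (z v)) := by
    intro v
    rw [tendsto_iff_norm_sub_tendsto_zero]
    exact t v
  apply vn_mem_of_comm
  intro m hm
  ext v
  have h1 : Tendsto (fun j => m (x j v)) atTop (nhds (m (z v))) :=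
    (m.continuous.tendsto _).comp (conv v)
  have h2 := conv (m v)
  refine tendsto_nhds_unique h1 (h2.congr fun j => ?_)
  exact congrArg (fun T : Op H => T v) (hm _ (hx j))
end

lemma span_uni (S : StarSubalgebra ℂ (Op H)) (hS : IsClosed (S : Set (Op H))) {x : Op H}
    (hx : x ∈ S) : x ∈ Submodule.span ℂ {u : Op H | u ∈ S ∧ u ∈ unitary (Op H)} := by
  have h := CStarAlgebra.span_unitary (A := S)
  have h1 : (⟨x, hx⟩ : S) ∈ Submodule.span ℂ (unitary S : Set S) := by rw [h]; trivial
  have h2 := Submodule.mem_map_of_mem (f := S.subtype.toLinearMap) h1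
  rw [Submodule.map_span] at h2
  refine Submodule.span_mono ?_ h2
  rintro _ ⟨u, hu, rfl⟩
  refine ⟨u.2, ?_⟩
  rw [SetLike.mem_coe, Unitary.mem_iff] at hu
  rw [Unitary.mem_iff]
  exact ⟨congrArg Subtype.val hu.1, congrArg Subtype.val hu.2⟩

lemma comm_of_uni (S : StarSubalgebra ℂ (Op H)) (hS : IsClosed (S : Set (Op H))) (z : Op H)
    (h : ∀ u ∈ S, u ∈ unitary (Op H) → u * z = z * u) {x : Op H} (hx : x ∈ S) :
    x * z = z * x := by
  have hx' := span_uni S hS hx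
  clear hx
  induction hx' using Submodule.span_induction with
  | mem u hu => exact h u hu.1 hu.2
  | zero => simp
  | add a b _ _ ha hb => rw [add_mul, mul_add, ha, hb]
  | smul c a _ ha => rw [smul_mul_assoc, mul_smul_comm, ha]

lemma uni_norm_le {g : Op H} (hg : g ∈ unitary (Op H)) : ‖g‖ ≤ 1 := by
  have := CStarRing.norm_mem_unitary_mul (1 : Op H) hg
  rw [mul_one] at this
  rw [this]
  exact ContinuousLinearMap.norm_id_le

lemma vn_closed (N : VonNeumannAlgebra H) : IsClosed (N : Set (Op H)) := by
  rw [← N.centralizer_centralizer]; exact Set.isClosed_centralizer _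

lemma conj_conj {ι : Type*} (b : ι → Op H) (g u : Op H) : (fun i => g * (fun i => u * b i * star u) i * star g) = fun i => (g * u) * b i * star (g * u) := by
      funext i
      simp only [star_mul, mul_assoc]
lemma conj_lin {ι : Type*} (x y : ι → Op H) (s t : ℝ) (g : Op H) : (fun i => g * (s • x + t • y) i * star g) =
          s • (fun i => g * x i * star g) + t • (fun i => g * y i * star g) := by
        funext i
        simp only [Pi.add_apply, Pi.smul_apply]
        rw [← Complex.coe_smul, ← Complex.coe_smul, ← Complex.coe_smul s (g * x i * star g),
          ← Complex.coe_smul t (g * y i * star g), mul_add, add_mul, mul_smul_comm, smul_mul_assoc,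
          mul_smul_comm, smul_mul_assoc]
lemma conj_convex {ι : Type*} (K : Set (ι → Op H)) (hKc : Convex ℝ K) (g : Op H) : Convex ℝ {x : ι → Op H | (fun i => g * x i * star g) ∈ K} := by
      intro x hx y hy s t hs ht hst
      have := hKc hx hy hs ht hst
      change (fun i => g * (s • x + t • y) i * star g) ∈ K
      rw [conj_lin]
      exact this

section
variable {ω : Ultrafilter ℕ} {M Mω : VonNeumannAlgebra H} {τ : Op H →ₗ[ℂ] ℂ}
  {limω : (ℕ → Op H) → Op H}

lemma free_le_atTop (hω : IsFreeUltrafilter ω) : (ω : Filter ℕ) ≤ atTop := by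
  intro s hs
  obtain ⟨j, hj⟩ := mem_atTop_sets.1 hs
  filter_upwards [free_ge hω j] with k hk using hj k hk

lemma averaging (hω : IsFreeUltrafilter ω) (hU : IsTracialUltrapower ω M Mω τ limω)
    (hτ : IsTracialState (M : Set (Op H)) τ) (N : VonNeumannAlgebra H)
    (hNM : (N : Set (Op H)) ⊆ (M : Set (Op H)))
    (hirr : relComm (N : Set (Op H)) (M : Set (Op H)) = scalars H)
    {ι : Type*} [Finite ι] (b : ι → Op H) (hb : ∀ i, b i ∈ M)
    (V : Set H) (hV : V.Finite) (η : ℝ) (hη : 0 < η) :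
    ∃ (κ : Type) (t : Finset κ) (w : κ → ℝ) (u : κ → Op H),
      (∀ s ∈ t, 0 ≤ w s) ∧ ∑ s ∈ t, w s = 1 ∧ (∀ s ∈ t, u s ∈ N ∧ u s ∈ unitary (Op H)) ∧
      ∀ i, ∀ v ∈ V, ‖(∑ s ∈ t, (w s : ℂ) • (u s * b i * star (u s)) - τ (b i) • 1) v‖ ≤ η := by
  cases nonempty_fintype ι
  set G : Set (ι → Op H) :=
    {x | ∃ u, u ∈ N ∧ u ∈ unitary (Op H) ∧ x = fun i => u * b i * star u} with hG
  set K : Set (ι → Op H) := convexHull ℝ G with hK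
  have hKc : Convex ℝ K := convex_convexHull ℝ G
  have hGK : G ⊆ K := subset_convexHull ℝ G
  have hK1 : K ⊆ {x | ∀ i, x i ∈ M ∧ ‖x i‖ ≤ ‖b i‖ ∧ τ (x i) = τ (b i)} := by
    apply convexHull_min
    · rintro _ ⟨u, hu, huu, rfl⟩ i
      have huM : u ∈ M := hNM hu
      refine ⟨mul_mem (mul_mem huM (hb i)) (star_mem huM), ?_, ?_⟩
      · rw [CStarRing.norm_mul_mem_unitary _ (Unitary.star_mem huu), CStarRing.norm_mem_unitary_mul _ huu]
      · rw [hτ.tracial _ (mul_mem huM (hb i)) _ (star_mem huM), ← mul_assoc,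
          Unitary.star_mul_self_of_mem huu, one_mul]
    · intro x hx y hy s t hs ht hst i
      obtain ⟨x1, x2, x3⟩ := hx i
      obtain ⟨y1, y2, y3⟩ := hy i
      simp only [Pi.add_apply, Pi.smul_apply]
      rw [← Complex.coe_smul, ← Complex.coe_smul]
      refine ⟨add_mem (vn_smul M _ x1) (vn_smul M _ y1), ?_, ?_⟩
      · refine (norm_add_le _ _).trans ?_
        rw [norm_smul, norm_smul, Complex.norm_real, Complex.norm_real, Real.norm_of_nonneg hs,
          Real.norm_of_nonneg ht]
        calc s * ‖x i‖ + t * ‖y i‖ ≤ s * ‖b i‖ + t * ‖b i‖ := by gcongr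
          _ = ‖b i‖ := by rw [← add_mul, hst, one_mul]
      · rw [map_add, map_smul, map_smul, x3, y3, ← add_smul, ← Complex.ofReal_add, hst]
        simp
  have hK2 : ∀ g ∈ N, g ∈ unitary (Op H) → ∀ x ∈ K, (fun i => g * x i * star g) ∈ K := by
    intro g hg hgu
    suffices K ⊆ {x | (fun i => g * x i * star g) ∈ K} from this
    refine convexHull_min ?_ (conj_convex K hKc g)
    intro x hx
    obtain ⟨u, hu, huu, hxu⟩ := hx
    change (fun i => g * x i * star g) ∈ K
    rw [hxu]
    have e := conj_conj b g u
    have hm : (fun i => (g * u) * b i * star (g * u)) ∈ G :=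
      ⟨g * u, mul_mem hg hu, mul_mem hgu huu, rfl⟩
    exact e ▸ hGK hm
  set f : (ι → Op H) → ℝ := fun x => ∑ i, q τ (x i) with hf
  have hf0 : ∀ x ∈ K, 0 ≤ f x := fun x hx => Finset.sum_nonneg fun i _ => q_nonneg hτ (hK1 hx i).1
  have hne : (f '' K).Nonempty := ⟨_, _, hGK ⟨1, one_mem N, one_mem _, rfl⟩, rfl⟩
  have hbdd : BddBelow (f '' K) := ⟨0, by rintro _ ⟨x, hx, rfl⟩; exact hf0 x hx⟩
  set I := sInf (f '' K) with hI
  have hIle : ∀ x ∈ K, I ≤ f x := fun x hx => csInf_le hbdd ⟨x, hx, rfl⟩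
  have hpar : ∀ x ∈ K, ∀ y ∈ K, ∀ i, q τ (x i - y i) ≤ 2 * (f x - I) + 2 * (f y - I) := by
    intro x hx y hy i
    have h1 : q τ (x i - y i) ≤ ∑ i, q τ (x i - y i) :=
      Finset.single_le_sum (f := fun i => q τ (x i - y i))
        (fun i _ => q_nonneg hτ (sub_mem (hK1 hx i).1 (hK1 hy i).1)) (Finset.mem_univ i)
    have h2 := hIle _ (hKc hx hy (a := 1 / 2) (b := 1 / 2) (by norm_num) (by norm_num) (by norm_num))
    have h3 : f ((1 / 2 : ℝ) • x + (1 / 2 : ℝ) • y) = 1 / 4 * ∑ i, q τ (x i + y i) := by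
      rw [hf, Finset.mul_sum]
      refine Finset.sum_congr rfl fun i _ => ?_
      simp only [Pi.add_apply, Pi.smul_apply]
      rw [← smul_add, ← Complex.coe_smul, q_smul]; norm_num
    have h4 : ∑ i, q τ (x i + y i) + ∑ i, q τ (x i - y i) = 2 * f x + 2 * f y := by
      simp only [hf, Finset.mul_sum, ← Finset.sum_add_distrib, q_par]
    linarith
  have hex : ∀ j : ℕ, ∃ x ∈ K, f x < I + (1 / 8) ^ j / 4 := by
    intro j
    obtain ⟨_, ⟨x, hx, rfl⟩, h⟩ := exists_lt_of_csInf_lt hne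
      (show sInf (f '' K) < I + (1 / 8) ^ j / 4 from lt_add_of_pos_right _ (by positivity))
    exact ⟨x, hx, h⟩
  choose x hxK hxf using hex
  have hxM : ∀ i, SeqIn (M : Set (Op H)) (fun j => x j i) := fun i j => (hK1 (hxK j) i).1
  have bx : ∀ i, Bdd (fun j => x j i) := fun i => ⟨‖b i‖, fun j => (hK1 (hxK j) i).2.1⟩
  have hpow : ∀ j : ℕ, ((1 : ℝ) / 8) ^ (j + 1) ≤ (1 / 8) ^ j := fun j =>
    pow_le_pow_of_le_one (by norm_num) (by norm_num) (by omega)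
  have hpow0 : Tendsto (fun j : ℕ => ((1 : ℝ) / 8) ^ j) ω (nhds 0) :=
    (tendsto_pow_atTop_nhds_zero_of_lt_one (by norm_num) (by norm_num)).mono_left (free_le_atTop hω)
  have zM : ∀ i, limω (fun j => x j i) ∈ M := by
    intro i
    refine strong_cauchy hω hU hτ (hxM i) (bx i) fun j => ?_
    have := hpar _ (hxK (j + 1)) _ (hxK j) i
    linarith [hxf j, hxf (j + 1), hpow j]
  have zg : ∀ i, ∀ g ∈ N, g ∈ unitary (Op H) →
      g * limω (fun j => x j i) = limω (fun j => x j i) * g := by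
    intro i g hg hgu
    have gM : g ∈ M := hNM hg
    have e1 : limω (fun j => g * x j i * star g) = g * limω (fun j => x j i) * star g := by
      rw [hU.map_mul (fun j => g * x j i) (fun _ => star g) (fun j => mul_mem gM (hxM i j))
        ((Bdd.const g).mul (bx i)) (fun _ => star_mem gM) (Bdd.const _),
        hU.map_mul (fun _ => g) (fun j => x j i) (fun _ => gM) (Bdd.const _) (hxM i) (bx i),
        hU.diag _ gM, hU.diag _ (star_mem gM)]
    have m1 : SeqIn (M : Set (Op H)) (fun j => g * x j i * star g) :=
      fun j => mul_mem (mul_mem gM (hxM i j)) (star_mem gM)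
    have b1 : Bdd (fun j => g * x j i * star g) := ((Bdd.const g).mul (bx i)).mul (Bdd.const _)
    have e2 : limω (fun j => g * x j i * star g - x j i) = 0 := by
      rw [lim_eq_zero hU hτ (fun j => sub_mem (m1 j) (hxM i j)) (b1.sub (bx i))]
      refine squeeze_zero (fun j => q_nonneg hτ (sub_mem (m1 j) (hxM i j))) (fun j => ?_) hpow0
      have hgK := hK2 g hg hgu _ (hxK j)
      have e3 : f (fun i => g * x j i * star g) ≤ f (x j) := by
        refine Finset.sum_le_sum fun i _ => ?_
        have g1 := q_mul_right hτ (star_mem gM) (mul_mem gM (hxM i j))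
        have g2 := q_mul_left hτ gM (hxM i j)
        have ng : ‖g‖ ≤ 1:= uni_norm_le hgu
        have ng2 : ‖g‖ ^ 2 ≤ 1 := pow_le_one₀ (norm_nonneg _) ng
        have p0 := q_nonneg hτ (hxM i j)
        have p1 := q_nonneg hτ (mul_mem gM (hxM i j))
        rw [norm_star] at g1
        simp only at g1 g2 p0 p1 ⊢
        nlinarith
      have := hpar _ hgK _ (hxK j) i
      linarith [hxf j]
    rw [lim_sub hU m1 b1 (hxM i) (bx i), sub_eq_zero, e1] at e2
    calc g * limω (fun j => x j i) = g * limω (fun j => x j i) * (star g * g) := by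
          rw [Unitary.star_mul_self_of_mem hgu, mul_one]
      _ = g * limω (fun j => x j i) * star g * g := by rw [← mul_assoc]
      _ = _ := by rw [e2]
  have zc : ∀ i, limω (fun j => x j i) = τ (b i) • 1 := by
    intro i
    have : limω (fun j => x j i) ∈ relComm (N : Set (Op H)) (M : Set (Op H)) :=
      ⟨zM i, fun y hy => comm_of_uni N.toStarSubalgebra (vn_closed N) _ (zg i) hy⟩
    rw [hirr] at this
    obtain ⟨c, hc⟩ := this
    have t := hU.tr _ (hxM i) (bx i)
    rw [hc] at t
    have e : (fun j => τ (x j i)) = fun _ => τ (b i) := by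
      funext j; exact (hK1 (hxK j) i).2.2
    rw [e] at t
    have := tendsto_nhds_unique t tendsto_const_nhds
    rw [map_smul, hτ.map_one, smul_eq_mul, mul_one] at this
    rw [hc, this]
  have cM : ∀ i, τ (b i) • (1 : Op H) ∈ M := fun i => vn_smul M _ (one_mem M)
  have fin : ∀ i v, ∀ᶠ j in (ω : Filter ℕ), ‖(x j i - τ (b i) • 1) v‖ ≤ η := by
    intro i v
    have e2 : limω (fun j => x j i - τ (b i) • 1) = 0 := by
      rw [lim_sub hU (hxM i) (bx i) (fun _ => cM i) (Bdd.const _), hU.diag _ (cM i), zc, sub_self]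
    rw [lim_eq_zero hU hτ (fun j => sub_mem (hxM i j) (cM i)) ((bx i).sub (Bdd.const _))] at e2
    have := strong_zero hω hU hτ (fun j => sub_mem (hxM i j) (cM i))
      ((bx i).sub (Bdd.const _)) e2 v
    exact (this.eventually (gt_mem_nhds hη)).mono fun j hj => hj.le
  have fin2 : ∀ᶠ j in (ω : Filter ℕ), ∀ i, ∀ v ∈ V, ‖(x j i - τ (b i) • 1) v‖ ≤ η :=
    eventually_all.2 fun i => (eventually_all_finite hV).2 fun v _ => fin i v
  obtain ⟨j, hj⟩ := fin2.exists
  have hx := hxK j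
  rw [hK, convexHull_eq] at hx
  obtain ⟨κ, t, w, z, hw, hw1, hz, hc⟩ := hx
  rw [Finset.centerMass_eq_of_sum_1 _ _ hw1] at hc
  have : ∀ s, ∃ u, s ∈ t → u ∈ N ∧ u ∈ unitary (Op H) ∧ z s = fun i => u * b i * star u := by
    intro s
    by_cases hs : s ∈ t
    · obtain ⟨u, hu⟩ := hz s hs
      exact ⟨u, fun _ => hu⟩
    · exact ⟨1, fun h => absurd h hs⟩
  choose u hu using this
  refine ⟨κ, t, w, u, hw, hw1, fun s hs => ⟨(hu s hs).1, (hu s hs).2.1⟩, fun i v hv => ?_⟩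
  have e : ∑ s ∈ t, (w s : ℂ) • (u s * b i * star (u s)) = x j i := by
    rw [← hc, Finset.sum_apply]
    refine Finset.sum_congr rfl fun s hs => ?_
    rw [Pi.smul_apply, (hu s hs).2.2, Complex.coe_smul]
  rw [e]
  exact hj i v hv
end

section
variable {ω : Ultrafilter ℕ} {M Mω : VonNeumannAlgebra H} {τ : Op H →ₗ[ℂ] ℂ}
  {limω : (ℕ → Op H) → Op H}

lemma stepOne (hω : IsFreeUltrafilter ω) (hU : IsTracialUltrapower ω M Mω τ limω)
    (hτ : IsTracialState (M : Set (Op H)) τ) (N : VonNeumannAlgebra H)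
    (hNM : (N : Set (Op H)) ⊆ (M : Set (Op H)))
    (hcs : relComm (M : Set (Op H)) (Mω : Set (Op H)) ⊆
      ultrapowerSet limω (N : Set (Op H)))
    (A : ℕ → StarSubalgebra ℂ (Op H)) (hA : Monotone A) (hAM : ∀ n, (A n : Set (Op H)) ⊆ M)
    (hA2 : Set.centralizer (Set.centralizer (⋃ n, (A n : Set (Op H)))) = (M : Set (Op H)))
    (y : Op H) (hy : ∀ g ∈ N, g * y = y * g) (w : H) (δ : ℝ) (hδ : 0 < δ) :
    ∃ n, ∀ u ∈ M, u ∈ unitary (Op H) → (∀ a ∈ A n, a * u = u * a) →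
      ∀ v ∈ N, v ∈ unitary (Op H) → ‖(y * u - u * y) (v w)‖ ≤ δ := by
  by_contra hc
  push Not at hc
  choose u huM huu hua v hv hvu hlt using hc
  have bu : Bdd u := ⟨1, fun n => uni_norm_le (huu n)⟩
  have bv : Bdd v := ⟨1, fun n => uni_norm_le (hvu n)⟩
  have hvM : SeqIn (M : Set (Op H)) v := fun n => hNM (hv n)
  set z := limω u with hz
  have zA : z ∈ Set.centralizer (⋃ n, (A n : Set (Op H))) := by
    rw [Set.mem_centralizer_iff]
    intro a ha
    obtain ⟨m, ham⟩ := Set.mem_iUnion.1 ha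
    have aM : a ∈ M := hAM m ham
    have e1 := hU.map_mul (fun _ => a) u (fun _ => aM) (Bdd.const a) huM bu
    have e2 := hU.map_mul u (fun _ => a) huM bu (fun _ => aM) (Bdd.const a)
    rw [hU.diag a aM] at e1 e2
    rw [← e1, ← e2]
    refine lim_congr hU hτ (fun n => mul_mem aM (huM n)) ((Bdd.const a).mul bu)
      (fun n => mul_mem (huM n) aM) (bu.mul (Bdd.const a)) ?_
    filter_upwards [free_ge hω m] with n hn
    exact hua n a (hA hn ham)
  have zr : z ∈ relComm (M : Set (Op H)) (Mω : Set (Op H)) := by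
    refine ⟨hU.mem u huM bu, fun m hm => ?_⟩
    rw [← hA2] at hm
    exact (Set.mem_centralizer_iff.1 hm z zA).symm
  obtain ⟨x, hx, bx, hxz⟩ := hcs zr
  have hxM : SeqIn (M : Set (Op H)) x := fun n => hNM (hx n)
  have dM : SeqIn (M : Set (Op H)) (fun n => (u n - x n) * v n) :=
    fun n => mul_mem (sub_mem (huM n) (hxM n)) (hvM n)
  have bd : Bdd (fun n => (u n - x n) * v n) := (bu.sub bx).mul bv
  have d0 : limω (fun n => (u n - x n) * v n) = 0 := by
    rw [hU.map_mul (fun n => u n - x n) v (fun n => sub_mem (huM n) (hxM n)) (bu.sub bx) hvM bv,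
      lim_sub hU huM bu hxM bx, hxz, sub_self, zero_mul]
  rw [lim_eq_zero hU hτ dM bd] at d0
  have t1 := strong_zero hω hU hτ dM bd d0 w
  have t2 := strong_zero hω hU hτ dM bd d0 (y w)
  have t3 := (t1.const_mul ‖y‖).add t2
  rw [mul_zero, add_zero] at t3
  obtain ⟨n, hn⟩ := (t3.eventually (gt_mem_nhds hδ)).exists
  have e : (y * u n - u n * y) * v n = y * ((u n - x n) * v n) - (u n - x n) * v n * y := by
    have h1 : v n * y = y * v n := hy _ (hv n)
    have h2 : x n * y = y * x n := hy _ (hx n)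
    calc (y * u n - u n * y) * v n = y * u n * v n - u n * (y * v n) := by noncomm_ring
      _ = y * u n * v n - u n * (v n * y) := by rw [h1]
      _ = y * u n * v n - (y * x n) * v n - u n * (v n * y) + (x n * y) * v n := by
        rw [h2]; noncomm_ring
      _ = y * u n * v n - (y * x n) * v n - u n * (v n * y) + x n * (v n * y) := by
        rw [h1]; noncomm_ring
      _ = _ := by noncomm_ring
  have e2 : (y * u n - u n * y) (v n w) = y (((u n - x n) * v n) w) - ((u n - x n) * v n) (y w) :=
    congrArg (fun T : Op H => T w) e
  have := hlt n
  rw [e2] at this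
  have l1 := norm_sub_le (y (((u n - x n) * v n) w)) (((u n - x n) * v n) (y w))
  have l2 := y.le_opNorm (((u n - x n) * v n) w)
  linarith
end

lemma finDim_inst (B : StarSubalgebra ℂ (Op H)) (hB : FinDim (B : Set (Op H))) :
    FiniteDimensional ℂ B := by
  obtain ⟨s, hs⟩ := hB
  have : B.toSubalgebra.toSubmodule ≤ Submodule.span ℂ (s : Set (Op H)) := hs
  exact Submodule.finiteDimensional_of_le this

lemma finDim_closed (B : StarSubalgebra ℂ (Op H)) (hB : FinDim (B : Set (Op H))) :
    IsClosed (B : Set (Op H)) := by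
  have : FiniteDimensional ℂ B.toSubalgebra.toSubmodule := finDim_inst B hB
  exact Submodule.closed_of_finiteDimensional B.toSubalgebra.toSubmodule

lemma compact_uni (B : StarSubalgebra ℂ (Op H)) (hB : FinDim (B : Set (Op H))) :
    CompactSpace (unitary B) := by
  have := finDim_inst B hB
  have : ProperSpace B := FiniteDimensional.proper ℂ B
  refine (isCompact_iff_compactSpace (s := (unitary B : Set B))).1 ?_
  apply Metric.isCompact_of_isClosed_isBounded
  · have : (unitary B : Set B) = {u | star u * u = 1} ∩ {u | u * star u = 1} := by
      ext u; simp [Unitary.mem_iff]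
    rw [this]
    refine (isClosed_eq ?_ continuous_const).inter (isClosed_eq ?_ continuous_const) <;> fun_prop
  · rw [isBounded_iff_forall_norm_le]
    refine ⟨1, fun u hu => ?_⟩
    rw [SetLike.mem_coe, Unitary.mem_iff] at hu
    exact uni_norm_le (g := (u : Op H))
      (Unitary.mem_iff.2 ⟨congrArg Subtype.val hu.1, congrArg Subtype.val hu.2⟩)

open MeasureTheory in
lemma haar_avg (B : StarSubalgebra ℂ (Op H)) (hB : FinDim (B : Set (Op H))) (y : Op H) :
    ∃ T : Op H, (∀ b ∈ B, b * T = T * b) ∧ ‖T‖ ≤ ‖y‖ ∧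
      ∀ (h : H) (δ : ℝ), (∀ u ∈ B, u ∈ unitary (Op H) → ‖(u * y * star u - y) h‖ ≤ δ) →
        ‖(T - y) h‖ ≤ δ := by
  have := compact_uni B hB
  let _ : MeasurableSpace (unitary B) := borel _
  have : BorelSpace (unitary B) := ⟨rfl⟩
  set μ : Measure (unitary B) := Measure.haarMeasure ⊤ with hμ
  have : IsProbabilityMeasure μ := ⟨by
    have := Measure.haarMeasure_self (K₀ := (⊤ : TopologicalSpace.PositiveCompacts (unitary B)))
    simpa using this⟩
  set c : unitary B → Op H := fun u => ((u : B) : Op H) with hc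
  have hcc : Continuous c := continuous_subtype_val.comp continuous_subtype_val
  have hcu : ∀ u, c u ∈ unitary (Op H) := fun u =>
    Unitary.mem_iff.2 ⟨congrArg Subtype.val (Unitary.mem_iff.1 u.2).1,
      congrArg Subtype.val (Unitary.mem_iff.1 u.2).2⟩
  set F : unitary B → Op H := fun u => c u * y * star (c u) with hF
  have hFc : Continuous F := (hcc.mul continuous_const).mul hcc.star
  have hFi : Integrable F μ := hFc.integrable_of_hasCompactSupport (HasCompactSupport.of_compactSpace F)
  set T : Op H := ∫ u, F u ∂μ with hT
  have inv : ∀ g, c g * T * star (c g) = T := by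
    intro g
    have h1 : c g * T * star (c g) = ∫ u, c g * F u * star (c g) ∂μ := by
      rw [hT, ← integral_const_mul_of_integrable hFi, ← integral_mul_const_of_integrable]
      exact hFi.const_mul _
    rw [h1]
    have h2 : ∀ u, c g * F u * star (c g) = F (g * u) := by
      intro u
      simp only [hF]
      have : c (g * u) = c g * c u := rfl
      rw [this, star_mul]; simp only [mul_assoc]
    simp only [h2]
    exact integral_mul_left_eq_self F g
  refine ⟨T, fun b hb => ?_, ?_, ?_⟩
  · refine comm_of_uni B (finDim_closed B hB) T (fun u hu huu => ?_) hb
    have := inv ⟨⟨u, hu⟩, Unitary.mem_iff.2 ⟨Subtype.ext (Unitary.mem_iff.1 huu).1,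
      Subtype.ext (Unitary.mem_iff.1 huu).2⟩⟩
    change u * T * star u = T at this
    calc u * T = u * T * (star u * u) := by rw [Unitary.star_mul_self_of_mem huu, mul_one]
      _ = u * T * star u * u := by rw [← mul_assoc]
      _ = _ := by rw [this]
  · refine (norm_integral_le_of_norm_le_const (C := ‖y‖) (ae_of_all _ fun u => ?_)).trans (by simp)
    simp only [hF]
    rw [CStarRing.norm_mul_mem_unitary _ (Unitary.star_mem (hcu u)), CStarRing.norm_mem_unitary_mul _ (hcu u)]
  · intro h δ hδ
    have e : (T - y) h = ∫ u, (F u - y) h ∂μ := by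
      have e1 := ContinuousLinearMap.integral_apply (hFi.sub (integrable_const y)) h
      have e2 := integral_sub hFi (integrable_const (μ := μ) y)
      have e3 : ∫ u, (F u - y) ∂μ = T - y := by rw [e2]; simp [hT]
      rw [← e3]
      exact e1
    rw [e]
    refine (norm_integral_le_of_norm_le_const (C := δ) (ae_of_all _ fun u => ?_)).trans (by simp)
    exact hδ (c u) (u : B).2 (hcu u)

lemma ultra_lim (ω : Ultrafilter ℕ) (T : ℕ → Op H) (C : ℝ) (hC : ∀ n, ‖T n‖ ≤ C) :
    ∃ S : Op H, ‖S‖ ≤ C ∧ ∀ h k : H, Tendsto (fun n => inner ℂ k (T n h)) ω (nhds (inner ℂ k (S h))) := by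
  have hC0 : 0 ≤ C := (norm_nonneg _).trans (hC 0)
  have hb : ∀ h k n, ‖inner ℂ (T n h) k‖ ≤ C * ‖h‖ * ‖k‖ := by
    intro h k n
    refine (norm_inner_le_norm _ _).trans ?_
    gcongr
    exact (T n).le_of_opNorm_le (hC n) h
  have ex : ∀ h k, ∃ l : ℂ, ‖l‖ ≤ C * ‖h‖ * ‖k‖ ∧ Tendsto (fun n => inner ℂ (T n h) k) ω (nhds l) := by
    intro h k
    have hcpt := isCompact_closedBall (0 : ℂ) (C * ‖h‖ * ‖k‖)
    obtain ⟨l, hl, hle⟩ := hcpt.ultrafilter_le_nhds (ω.map (fun n => inner ℂ (T n h) k)) (by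
      rw [le_principal_iff]
      exact Filter.mem_map.2 (Filter.univ_mem' fun n => by simpa using hb h k n))
    exact ⟨l, by simpa using hl, hle⟩
  choose L hL1 hL2 using ex
  have uniq : ∀ {h k l}, Tendsto (fun n => inner ℂ (T n h) k) ω (nhds l) → L h k = l :=
    fun ht => tendsto_nhds_unique (hL2 _ _) ht
  let Lm : H →ₗ⋆[ℂ] H →ₗ[ℂ] ℂ := LinearMap.mk₂'ₛₗ (starRingEnd ℂ) (RingHom.id ℂ) L
    (fun a b k => uniq (by simpa [inner_add_left] using (hL2 a k).add (hL2 b k)))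
    (fun c a k => uniq (by simpa [inner_smul_left, mul_comm] using (hL2 a k).const_mul (starRingEnd ℂ c)))
    (fun a k l => uniq (by simpa [inner_add_right] using (hL2 a k).add (hL2 a l)))
    (fun c a k => uniq (by simpa [inner_smul_right] using (hL2 a k).const_mul c))
  let Lc : H →L⋆[ℂ] H →L[ℂ] ℂ := Lm.mkContinuous₂ C hL1
  let S : Op H := InnerProductSpace.continuousLinearMapOfBilin Lc
  have hS : ∀ h k, inner ℂ (S h) k = L h k := fun h k =>
    InnerProductSpace.continuousLinearMapOfBilin_apply Lc h k
  refine ⟨S, ?_, ?_⟩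
  · refine ContinuousLinearMap.opNorm_le_bound _ hC0 fun h => ?_
    by_cases h0 : S h = 0
    · rw [h0, norm_zero]; positivity
    have h1 := hL1 h (S h)
    rw [← hS] at h1
    have h2 : ‖inner ℂ (S h) (S h)‖ = ‖S h‖ * ‖S h‖ := by
      rw [inner_self_eq_norm_sq_to_K]; simp [sq]
    rw [h2] at h1
    exact le_of_mul_le_mul_right h1 (norm_pos_iff.2 h0)
  · intro h k
    have := (hL2 h k)
    rw [← hS] at this
    have := (Complex.continuous_conj.tendsto _).comp this
    simpa [Function.comp_def, inner_conj_symm] using this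

lemma stepT {ω : Ultrafilter ℕ} (hω : IsFreeUltrafilter ω) (M : VonNeumannAlgebra H)
    (A : ℕ → StarSubalgebra ℂ (Op H)) (hA : Monotone A) (hAM : ∀ n, (A n : Set (Op H)) ⊆ M)
    (hfd : ∀ n, FinDim (A n : Set (Op H))) (n : ℕ) (y : Op H) :
    ∃ T : Op H, ‖T‖ ≤ ‖y‖ ∧ (∀ m, ∀ b ∈ A m, (∀ a ∈ A n, a * b = b * a) → b * T = T * b) ∧
      ∀ (h : H) (δ : ℝ), (∀ u ∈ M, u ∈ unitary (Op H) → (∀ a ∈ A n, a * u = u * a) →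
        ‖(u * y * star u - y) h‖ ≤ δ) → ‖(T - y) h‖ ≤ δ := by
  set B : ℕ → StarSubalgebra ℂ (Op H) :=
    fun m => A m ⊓ StarSubalgebra.centralizer ℂ (A n : Set (Op H)) with hB
  have memB : ∀ m b, b ∈ B m ↔ b ∈ A m ∧ ∀ a ∈ A n, a * b = b * a := by
    intro m b
    rw [hB, StarSubalgebra.mem_inf, StarSubalgebra.mem_centralizer_iff]
    exact ⟨fun h => ⟨h.1, fun a ha => (h.2 a ha).1⟩,
      fun h => ⟨h.1, fun a ha => ⟨h.2 a ha, h.2 _ (star_mem ha)⟩⟩⟩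
  have fdB : ∀ m, FinDim (B m : Set (Op H)) := by
    intro m
    obtain ⟨s, hs⟩ := hfd m
    exact ⟨s, fun b hb => hs ((memB m b).1 hb).1⟩
  choose t ht1 ht2 ht3 using fun m => haar_avg (B m) (fdB m) y
  obtain ⟨T, hT1, hT2⟩ := ultra_lim ω t ‖y‖ ht2
  refine ⟨T, hT1, ?_, ?_⟩
  · intro m b hb hbc
    ext h
    refine ext_inner_left ℂ fun k => ?_
    have h1 := hT2 h (star b k)
    have h2 := hT2 (b h) k
    have e : ∀ z, inner ℂ (star b k) z = inner ℂ k (b z) := fun z =>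
      ContinuousLinearMap.adjoint_inner_left b z k
    simp only [e] at h1
    refine tendsto_nhds_unique h1 (h2.congr' ?_)
    filter_upwards [free_ge hω m] with l hl
    have := ht1 l b ((memB l b).2 ⟨hA hl hb, hbc⟩)
    have := congrArg (fun S : Op H => inner ℂ k (S h)) this
    exact this.symm
  · intro h δ hδ
    have hb : ∀ m, ‖(t m - y) h‖ ≤ δ := fun m => ht3 m h δ fun u hu huu =>
      hδ u (hAM m ((memB m u).1 hu).1) huu ((memB m u).1 hu).2
    have hδ0 : 0 ≤ δ := (norm_nonneg _).trans (hb 0)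
    by_cases h0 : (T - y) h = 0
    · rw [h0, norm_zero]; exact hδ0
    set k := (T - y) h with hk
    have l1 : Tendsto (fun m => inner ℂ k ((t m - y) h)) ω (nhds (inner ℂ k ((T - y) h))) := by
      simpa [inner_sub_right] using (hT2 h k).sub_const (inner ℂ k (y h))
    have l2 := le_of_tendsto l1.norm (Eventually.of_forall fun m =>
      (norm_inner_le_norm _ _).trans (mul_le_mul_of_nonneg_left (hb m) (norm_nonneg k)))
    rw [← hk, inner_self_eq_norm_sq_to_K] at l2
    have l3 : ‖k‖ * ‖k‖ ≤ ‖k‖ * δ := by simpa [sq] using l2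
    exact le_of_mul_le_mul_left l3 (norm_pos_iff.2 h0)

lemma bicomm_aux {L : Type*} [Fintype L] [DecidableEq L]
    {E : Type*} [NormedAddCommGroup E] [InnerProductSpace ℂ E] [CompleteSpace E]
    (ι : L → H →L[ℂ] E) (π : L → E →L[ℂ] H)
    (hin : ∀ ξ η : E, inner ℂ ξ η = ∑ l, inner ℂ (π l ξ) (π l η))
    (hsum : ∀ ξ : E, ξ = ∑ k, ι k (π k ξ))
    (hπι : ∀ l k h, π l (ι k h) = if l = k then h else 0)
    (S : Set (Op H)) (h1 : (1 : Op H) ∈ S)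
    (hmul : ∀ x ∈ S, ∀ y ∈ S, x * y ∈ S) (hstar : ∀ x ∈ S, star x ∈ S)
    (d w : L → H) (h0 : ∀ x ∈ S, ∑ l, inner ℂ (w l) (x (d l)) = 0)
    {x : Op H} (hx : x ∈ Set.centralizer (Set.centralizer S)) :
    ∑ l, inner ℂ (w l) (x (d l)) = 0 := by
  have ext' : ∀ ξ η : E, (∀ l, π l ξ = π l η) → ξ = η := by
    intro ξ η h
    rw [hsum ξ, hsum η]; simp only [h]
  have mk : ∀ f : L → H, ∀ l, π l (∑ k, ι k (f k)) = f l := by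
    intro f l
    rw [map_sum]; simp [hπι]
  obtain ⟨D, hD⟩ : ∃ D : Op H → E →L[ℂ] E, ∀ s ξ l, π l (D s ξ) = s (π l ξ) := by
    refine ⟨fun s => ∑ k, ι k ∘L s ∘L π k, fun s ξ l => ?_⟩
    rw [sum_apply]
    exact mk (fun k => s (π k ξ)) l
  obtain ⟨d', hd'⟩ : ∃ d' : E, ∀ l, π l d' = d l := ⟨_, mk d⟩
  obtain ⟨w', hw'⟩ : ∃ w' : E, ∀ l, π l w' = w l := ⟨_, mk w⟩
  have hw'x : ∀ s, inner ℂ w' (D s d') = ∑ l, inner ℂ (w l) (s (d l)) := by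
    intro s
    rw [hin]; simp only [hD, hd', hw']
  have Dadj : ∀ (s : Op H) (ξ η : E), inner ℂ (D s ξ) η = inner ℂ ξ (D (star s) η) := by
    intro s ξ η
    rw [hin, hin ξ]
    simp only [hD]
    exact Finset.sum_congr rfl fun l _ =>
      (ContinuousLinearMap.adjoint_inner_right s (π l ξ) (π l η)).symm
  set W : Submodule ℂ E := Submodule.span ℂ ((fun s => D s d') '' S) with hW
  have memF : ∀ ξ : E, ξ ∈ Wᗮ ↔ ∀ s ∈ S, inner ℂ (D s d') ξ = 0 := by
    intro ξ
    constructor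
    · intro h s hs
      exact (Submodule.mem_orthogonal _ _).1 h _ (Submodule.subset_span ⟨s, hs, rfl⟩)
    · intro h
      refine (Submodule.mem_orthogonal _ _).2 fun u hu => ?_
      induction hu using Submodule.span_induction with
      | mem u hu => obtain ⟨s, hs, rfl⟩ := hu; exact h s hs
      | zero => simp
      | add a b _ _ ha hb => rw [inner_add_left, ha, hb, add_zero]
      | smul c a _ ha => rw [inner_smul_left, ha, mul_zero]
  have Finv : ∀ s ∈ S, ∀ ξ ∈ Wᗮ, D s ξ ∈ Wᗮ := by
    intro s hs ξ hξ
    rw [memF] at hξ ⊢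
    intro r hr
    have e := Dadj (star s) (D r d') ξ
    rw [star_star] at e
    rw [← e]
    have e2 : D (star s) (D r d') = D (star s * r) d' := by
      apply ext'; intro l; rw [hD, hD, hD]; rfl
    rw [e2]
    exact hξ _ (hmul _ (hstar s hs) _ hr)
  set P : E →L[ℂ] E := (Wᗮ).starProjection with hP
  have DP : ∀ s ∈ S, ∀ ξ, P (D s ξ) = D s (P ξ) := by
    intro s hs ξ
    refine Submodule.eq_starProjection_of_mem_of_inner_eq_zero
      (Finv s hs _ (Submodule.starProjection_apply_mem _ ξ)) fun η hη => ?_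
    rw [← map_sub, Dadj]
    exact Submodule.starProjection_inner_eq_zero ξ _ (Finv _ (hstar s hs) _ hη)
  have Dι : ∀ s k h, D s (ι k h) = ι k (s h) := by
    intro s k h
    apply ext'
    intro l
    rw [hD, hπι, hπι]
    split_ifs <;> simp
  have Pe : ∀ (l k : L), (π l ∘L P ∘L ι k : Op H) ∈ Set.centralizer S := by
    intro l k
    rw [Set.mem_centralizer_iff]
    intro s hs
    ext h
    change s (π l (P (ι k h))) = π l (P (ι k (s h)))
    rw [← Dι, DP s hs, hD]
  have D1 : D 1 d' = d' := by apply ext'; intro l; rw [hD]; rfl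
  have Pd : P d' = 0 := by
    refine Submodule.eq_starProjection_of_mem_of_inner_eq_zero (zero_mem _) fun η hη => ?_
    have := (memF η).1 hη 1 h1
    rwa [sub_zero, ← D1]
  have DPx : ∀ ξ, P (D x ξ) = D x (P ξ) := by
    intro ξ
    apply ext'
    intro l
    rw [hD]
    have e1 : D x ξ = ∑ k, ι k (x (π k ξ)) := by
      conv_lhs => rw [hsum (D x ξ)]
      simp only [hD]
    rw [e1]
    conv_rhs => rw [hsum ξ]
    simp only [map_sum]
    refine Finset.sum_congr rfl fun k _ => ?_
    have := Set.mem_centralizer_iff.1 hx _ (Pe l k)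
    exact congrArg (fun T : Op H => T (π k ξ)) this
  have w'F : w' ∈ Wᗮ := by
    rw [memF]
    intro s hs
    rw [← inner_conj_symm, hw'x, h0 s hs, map_zero]
  have P0 : P (D x d') = 0 := by rw [DPx, Pd, map_zero]
  have fin := Submodule.starProjection_inner_eq_zero (K := Wᗮ) (D x d') w' w'F
  rw [← hP, P0, sub_zero, ← inner_conj_symm, hw'x, map_eq_zero] at fin
  exact fin

/-- Amplified density: vanishing of a finite-rank normal functional passes to the bicommutant. -/
lemma bicomm {L : Type*} [Fintype L] (S : Set (Op H)) (h1 : (1 : Op H) ∈ S)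
    (hmul : ∀ x ∈ S, ∀ y ∈ S, x * y ∈ S) (hstar : ∀ x ∈ S, star x ∈ S)
    (d w : L → H) (h0 : ∀ x ∈ S, ∑ l, inner ℂ (w l) (x (d l)) = 0)
    {x : Op H} (hx : x ∈ Set.centralizer (Set.centralizer S)) :
    ∑ l, inner ℂ (w l) (x (d l)) = 0 := by
  classical
  refine bicomm_aux (E := PiLp 2 (fun _ : L => H))
    (fun k => (PiLp.continuousLinearEquiv 2 ℂ (fun _ : L => H)).symm.toContinuousLinearMap ∘L
      ContinuousLinearMap.single ℂ (fun _ : L => H) k)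
    (fun l => PiLp.proj 2 (fun _ : L => H) l) ?_ ?_ ?_ S h1 hmul hstar d w h0 hx
  · intro ξ η
    rw [PiLp.inner_apply]; rfl
  · intro ξ
    ext l
    simp [Finset.sum_pi_single]
  · intro l k h
    by_cases hl : l = k
    · subst hl; simp
    · simp [hl]

lemma casimir {M : VonNeumannAlgebra H} {τ : Op H →ₗ[ℂ] ℂ}
    (hτ : IsTracialState (M : Set (Op H)) τ) (A : StarSubalgebra ℂ (Op H))
    (hAM : (A : Set (Op H)) ⊆ M) (hfd : FinDim (A : Set (Op H))) :
    ∃ (r : ℕ) (b b' : Fin r → Op H), (∀ i, b i ∈ A) ∧ (∀ i, b' i ∈ A) ∧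
      (∀ a ∈ A, ∀ x : Op H, a * ∑ i, b i * x * b' i = (∑ i, b i * x * b' i) * a) ∧
      ∑ i, τ (b' i) • b i = 1 := by
  have := finDim_inst A hfd
  let B : LinearMap.BilinForm ℂ A := LinearMap.mk₂ ℂ (fun a c => τ ((a : Op H) * (c : Op H)))
    (by intro a b c; simp [add_mul]) (by intro c a b; simp)
    (by intro a b c; simp [mul_add]) (by intro c a b; simp)
  have hB : ∀ a c : A, B a c = τ ((a : Op H) * (c : Op H)) := fun a c => rfl
  have hBsymm : ∀ a c : A, B a c = B c a := fun a c => hτ.tracial _ (hAM a.2) _ (hAM c.2)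
  have hl : ∀ a : A, (∀ c, B a c = 0) → a = 0 := by
    intro a h
    have h1 := h (star a)
    rw [hBsymm] at h1
    exact Subtype.ext (hτ.faithful _ (hAM a.2) h1)
  have hnd : B.Nondegenerate :=
    ⟨hl, fun a h => hl a fun c => by rw [hBsymm]; exact h c⟩
  let e := Module.finBasis ℂ A
  let e' := B.dualBasis hnd e
  have dual : ∀ i j, B (e' i) (e j) = if j = i then 1 else 0 :=
    fun i j => LinearMap.BilinForm.apply_dualBasis_left hnd e i j
  have ex1 : ∀ c : A, c = ∑ j, B (e' j) c • e j := by
    intro c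
    have h : ∀ i, B (e' i) c = e.repr c i := by
      intro i
      conv_lhs => rw [← e.sum_repr c]
      simp only [map_sum, map_smul, smul_eq_mul, dual, mul_ite, mul_one, mul_zero,
        Finset.sum_ite_eq', Finset.sum_ite_eq, Finset.mem_univ, if_true]
    simp only [h]
    exact (e.sum_repr c).symm
  have ex2 : ∀ c : A, c = ∑ j, B c (e j) • e' j := by
    intro c
    have h : ∀ i, B c (e i) = e'.repr c i := by
      intro i
      conv_lhs => rw [← e'.sum_repr c]
      simp only [map_sum, map_smul, LinearMap.sum_apply, LinearMap.smul_apply, smul_eq_mul, dual,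
        mul_ite, mul_one, mul_zero,
        Finset.sum_ite_eq', Finset.sum_ite_eq, Finset.mem_univ, if_true]
    simp only [h]
    exact (e'.sum_repr c).symm
  have val : ∀ (f : Fin (Module.finrank ℂ A) → ℂ) (g : Fin (Module.finrank ℂ A) → A),
      ((∑ j, f j • g j : A) : Op H) = ∑ j, f j • (g j : Op H) := by
    intro f g
    simp
  refine ⟨_, fun i => e i, fun i => e' i, fun i => (e i).2, fun i => (e' i).2, ?_, ?_⟩
  · intro a ha x
    rw [Finset.mul_sum, Finset.sum_mul]
    have c1 : ∀ i, a * (e i : Op H) = ∑ j, B (e' j) (⟨a, ha⟩ * e i) • (e j : Op H) := by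
      intro i
      rw [← val, ← ex1]; rfl
    have c2 : ∀ j, (e' j : Op H) * a = ∑ i, B (e' j * ⟨a, ha⟩) (e i) • (e' i : Op H) := by
      intro j
      rw [← val, ← ex2]; rfl
    have c3 : ∀ i j, B (e' j * ⟨a, ha⟩) (e i) = B (e' j) (⟨a, ha⟩ * e i) := by
      intro i j
      rw [hB, hB]
      exact congrArg τ (mul_assoc _ _ _)
    calc ∑ i, a * ((e i : Op H) * x * (e' i : Op H))
        = ∑ i, ∑ j, B (e' j) (⟨a, ha⟩ * e i) • ((e j : Op H) * x * (e' i : Op H)) := by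
          refine Finset.sum_congr rfl fun i _ => ?_
          rw [← mul_assoc, ← mul_assoc, c1, Finset.sum_mul, Finset.sum_mul]
          simp only [smul_mul_assoc]
      _ = ∑ j, ∑ i, B (e' j) (⟨a, ha⟩ * e i) • ((e j : Op H) * x * (e' i : Op H)) :=
          Finset.sum_comm
      _ = ∑ j, (e j : Op H) * x * (e' j : Op H) * a := by
          refine Finset.sum_congr rfl fun j _ => ?_
          rw [mul_assoc _ _ a, c2, Finset.mul_sum]
          simp only [c3, mul_smul_comm]
  · have h := ex1 1
    have h2 := congrArg (fun z : A => (z : Op H)) h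
    simp only [val] at h2
    rw [show ((1 : A) : Op H) = 1 from rfl] at h2
    conv_rhs => rw [h2]
    refine Finset.sum_congr rfl fun j _ => ?_
    rw [hB]
    simp

lemma casimir_comm (A : ℕ → StarSubalgebra ℂ (Op H)) (hA : Monotone A) (n : ℕ) (T : Op H)
    (hT : ∀ m, ∀ b ∈ A m, (∀ a ∈ A n, a * b = b * a) → b * T = T * b)
    {r : ℕ} (b b' : Fin r → Op H) (hb : ∀ i, b i ∈ A n) (hb' : ∀ i, b' i ∈ A n)
    (hC : ∀ a ∈ A n, ∀ x : Op H, a * ∑ i, b i * x * b' i = (∑ i, b i * x * b' i) * a)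
    {z : Op H} (hz : z ∈ Set.centralizer (Set.centralizer (⋃ n, (A n : Set (Op H))))) :
    (∑ i, b i * z * b' i) * T = T * ∑ i, b i * z * b' i := by
  ext h
  refine ext_inner_left ℂ fun k => ?_
  rw [← sub_eq_zero]
  have key : ∀ x : Op H, inner ℂ k (((∑ i, b i * x * b' i) * T) h)
      - inner ℂ k ((T * ∑ i, b i * x * b' i) h) =
      ∑ l : Fin r ⊕ Fin r, inner ℂ
        (Sum.elim (fun i => star (b i) k) (fun i => - star (b i) (star T k)) l)
        (x (Sum.elim (fun i => b' i (T h)) (fun i => b' i h) l)) := by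
    intro x
    have adj : ∀ (S : Op H) (a c : H), inner ℂ (star S a) c = inner ℂ a (S c) := fun S a c =>
      ContinuousLinearMap.adjoint_inner_left S c a
    rw [Fintype.sum_sum_type]
    simp only [Sum.elim_inl, Sum.elim_inr, inner_neg_left, adj, Finset.sum_neg_distrib,
      ← sub_eq_add_neg]
    simp [sum_apply, inner_sum]
  rw [key]
  refine bicomm (⋃ n, (A n : Set (Op H))) (Set.mem_iUnion.2 ⟨0, one_mem (A 0)⟩) ?_ ?_ _ _ ?_ hz
  · intro x hx y hy
    obtain ⟨i, hi⟩ := Set.mem_iUnion.1 hx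
    obtain ⟨j, hj⟩ := Set.mem_iUnion.1 hy
    exact Set.mem_iUnion.2 ⟨max i j, mul_mem (hA (le_max_left i j) hi) (hA (le_max_right i j) hj)⟩
  · intro x hx
    obtain ⟨i, hi⟩ := Set.mem_iUnion.1 hx
    exact Set.mem_iUnion.2 ⟨i, star_mem hi⟩
  · intro x hx
    obtain ⟨m, hm⟩ := Set.mem_iUnion.1 hx
    rw [← key, hT (max m n) _ _ (fun a ha => hC a ha x), sub_self]
    exact sum_mem fun i _ => mul_mem (mul_mem (hA (le_max_right m n) (hb i))
      (hA (le_max_left m n) hm)) (hA (le_max_right m n) (hb' i))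

lemma swap_T {r : ℕ} (b b' : Fin r → Op H) (T x : Op H) {κ : Type} (t : Finset κ) (c : κ → ℂ)
    (u : κ → Op H) (h : ∀ s ∈ t, (∑ i, b i * (x * u s) * b' i) * T =
      T * ∑ i, b i * (x * u s) * b' i) :
    ∑ i, b i * x * (∑ s ∈ t, c s • (u s * b' i * T * star (u s))) =
      T * ∑ i, b i * x * (∑ s ∈ t, c s • (u s * b' i * star (u s))) := by
  calc ∑ i, b i * x * (∑ s ∈ t, c s • (u s * b' i * T * star (u s)))
      = ∑ s ∈ t, c s • (((∑ i, b i * (x * u s) * b' i) * T) * star (u s)) := by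
        simp only [Finset.mul_sum, Finset.sum_mul, Finset.smul_sum, mul_smul_comm]
        rw [Finset.sum_comm]
        simp only [mul_assoc]
    _ = ∑ s ∈ t, c s • ((T * (∑ i, b i * (x * u s) * b' i)) * star (u s)) :=
        Finset.sum_congr rfl fun s hs => by rw [h s hs]
    _ = _ := by
        simp only [Finset.mul_sum, Finset.sum_mul, Finset.smul_sum, mul_smul_comm]
        rw [Finset.sum_comm]
        simp only [mul_assoc]

lemma uni_apply_norm {v : Op H} (hv : v ∈ unitary (Op H)) (h : H) : ‖v h‖ ≤ ‖h‖ := by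
  simpa using v.le_of_opNorm_le (uni_norm_le hv) h

section
variable {ω : Ultrafilter ℕ} {M Mω : VonNeumannAlgebra H} {τ : Op H →ₗ[ℂ] ℂ}
  {limω : (ℕ → Op H) → Op H}

lemma main_est (hω : IsFreeUltrafilter ω) (hU : IsTracialUltrapower ω M Mω τ limω)
    (hM : IsII1Factor M τ) (hMhf : IsHyperfinite M) (N : VonNeumannAlgebra H)
    (hNM : (N : Set (Op H)) ⊆ (M : Set (Op H)))
    (hirr : relComm (N : Set (Op H)) (M : Set (Op H)) = scalars H)
    (hcs : relComm (M : Set (Op H)) (Mω : Set (Op H)) ⊆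
      ultrapowerSet limω (N : Set (Op H)))
    (y : Op H) (hy : ∀ g ∈ N, g * y = y * g) (x : Op H) (hx : x ∈ M) (w : H) (δ : ℝ)
    (hδ : 0 < δ) :
    ∃ t' : H, ∀ X : Op H, X = x ∨ X = 1 → ‖y (X w) - X t'‖ ≤ δ * (2 + ‖X‖) := by
  have hτ := hM.trace
  obtain ⟨A, hA, hAM, hfd, hA2⟩ := hMhf
  obtain ⟨n1, hn1⟩ := stepOne hω hU hτ N hNM hcs A hA hAM hA2 y hy (x w) δ hδ
  obtain ⟨n2, hn2⟩ := stepOne hω hU hτ N hNM hcs A hA hAM hA2 y hy w δ hδ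
  set n := max n1 n2 with hn
  obtain ⟨T, hT1, hT2, hT3⟩ := stepT hω M A hA hAM hfd n y
  have close : ∀ X : Op H, X = x ∨ X = 1 → ∀ v ∈ N, v ∈ unitary (Op H) →
      ‖(T - y) (v (X w))‖ ≤ δ := by
    intro X hX v hv hvu
    refine hT3 _ _ fun u hu huu hua => ?_
    have hs : ∀ a ∈ A n, a * star u = star u * a := by
      intro a ha
      have := congrArg star (hua (star a) (star_mem ha))
      rw [star_mul, star_mul, star_star] at this
      exact this.symm
    have h1 : ‖(y * star u - star u * y) (v (X w))‖ ≤ δ := by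
      rcases hX with rfl | rfl
      · exact hn1 (star u) (star_mem hu) (Unitary.star_mem huu)
          (fun a ha => hs a (hA (le_max_left n1 n2) ha)) v hv hvu
      · exact hn2 (star u) (star_mem hu) (Unitary.star_mem huu)
          (fun a ha => hs a (hA (le_max_right n1 n2) ha)) v hv hvu
    have e : u * y * star u - y = u * (y * star u - star u * y) := by
      rw [mul_sub, ← mul_assoc, ← mul_assoc, Unitary.mul_star_self_of_mem huu, one_mul]
    rw [e]
    exact (uni_apply_norm huu _).trans h1
  obtain ⟨r, b, b', hb, hb', hC, hC1⟩ := casimir hτ (A n) (hAM n) (hfd n)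
  have hTC : ∀ z ∈ M, (∑ i, b i * z * b' i) * T = T * ∑ i, b i * z * b' i := by
    intro z hz
    refine casimir_comm A hA n T hT2 b b' hb hb' hC ?_
    rw [hA2]; exact hz
  set Λ := ∑ i, ‖b i‖ with hΛ
  have hΛ0 : 0 ≤ Λ := Finset.sum_nonneg fun i _ => norm_nonneg _
  set η := δ / (1 + ‖y‖ * Λ) with hη
  have hη0 : 0 < η := by positivity
  have hηδ : ‖y‖ * (Λ * η) ≤ δ := by
    rw [hη, ← mul_assoc, ← mul_div_assoc, div_le_iff₀ (by positivity)]
    nlinarith [norm_nonneg y, mul_nonneg (norm_nonneg y) hΛ0]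
  obtain ⟨κ, t, c, u, hc0, hc1, hu, hav⟩ := averaging hω hU hτ M (fun _ h => h) hM.factor b'
    (fun i => hAM n (hb' i)) {w} (Set.finite_singleton w) η hη0
  set ti : Fin r → H := fun i => (∑ s ∈ t, (c s : ℂ) • (u s * b' i * T * star (u s))) w with hti
  have est1 : ∀ x' ∈ M, ‖T (x' w) - ∑ i, b i (x' (ti i))‖ ≤ δ * ‖x'‖ := by
    intro x' hx'
    have sw := swap_T b b' T x' t (fun s => (c s : ℂ)) u
      (fun s hs => hTC _ (mul_mem hx' (hu s hs).1))
    have sw2 := congrArg (fun S : Op H => S w) sw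
    have l1 : (∑ i, b i * x' * (∑ s ∈ t, (c s : ℂ) • (u s * b' i * T * star (u s)))) w =
        ∑ i, b i (x' (ti i)) := by
      rw [sum_apply]; rfl
    have l2 : x' w = (∑ i, b i * x' * (τ (b' i) • 1)) w := by
      have : ∑ i, b i * x' * (τ (b' i) • 1) = (∑ i, τ (b' i) • b i) * x' := by
        rw [Finset.sum_mul]
        refine Finset.sum_congr rfl fun i _ => ?_
        rw [mul_smul_comm, mul_one, smul_mul_assoc]
      rw [this, hC1, one_mul]
    have l3 : T (x' w) - ∑ i, b i (x' (ti i)) =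
        - T (∑ i, b i (x' ((∑ s ∈ t, (c s : ℂ) • (u s * b' i * star (u s)) - τ (b' i) • 1) w))) := by
      rw [← l1]
      rw [show _ = _ from sw2]
      conv_lhs => rw [l2]
      rw [ContinuousLinearMap.mul_apply, ← map_sub, ← map_neg]
      congr 1
      simp only [sum_apply, ContinuousLinearMap.mul_apply, ContinuousLinearMap.sub_apply, map_sub,
        Finset.sum_sub_distrib, neg_sub]
    rw [l3, norm_neg]
    refine (T.le_of_opNorm_le hT1 _).trans ?_
    have l4 : ‖∑ i, b i (x' ((∑ s ∈ t, (c s : ℂ) • (u s * b' i * star (u s)) - τ (b' i) • 1) w))‖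
        ≤ Λ * (‖x'‖ * η) := by
      refine (norm_sum_le _ _).trans ?_
      rw [hΛ, Finset.sum_mul]
      refine Finset.sum_le_sum fun i _ => ?_
      refine ((b i).le_opNorm _).trans ?_
      gcongr
      refine (x'.le_opNorm _).trans ?_
      gcongr
      exact hav i w rfl
    calc _ ≤ ‖y‖ * (Λ * (‖x'‖ * η)) := by gcongr
      _ = ‖y‖ * (Λ * η) * ‖x'‖ := by ring
      _ ≤ δ * ‖x'‖ := by gcongr
  have est2 : ∀ X : Op H, X = x ∨ X = 1 → ∀ v ∈ N, v ∈ unitary (Op H) →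
      ‖y (X w) - ∑ i, (v * b i * star v) (X (ti i))‖ ≤ δ * (1 + ‖X‖) := by
    intro X hX v hv hvu
    have hXM : X ∈ M := by
      rcases hX with rfl | rfl
      · exact hx
      · exact one_mem M
    have h1 := close X hX (star v) (star_mem hv) (Unitary.star_mem hvu)
    have h2 := est1 (star v * X) (mul_mem (star_mem (hNM hv)) hXM)
    have h3 : ‖star v * X‖ ≤ ‖X‖ := by
      rw [CStarRing.norm_mem_unitary_mul _ (Unitary.star_mem hvu)]
    have e : y (X w) - ∑ i, (v * b i * star v) (X (ti i)) =
        v (- (T - y) (star v (X w)) + (T ((star v * X) w) - ∑ i, b i ((star v * X) (ti i)))) := by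
      have e1 : v * (y * star v) = y := by
        rw [← mul_assoc, hy v hv, mul_assoc, Unitary.mul_star_self_of_mem hvu, mul_one]
      have e2 : v (y (star v (X w))) = y (X w) := congrArg (fun S : Op H => S (X w)) e1
      simp only [ContinuousLinearMap.sub_apply, ContinuousLinearMap.mul_apply, map_add, map_sub,
        map_neg, map_sum, e2]
      abel
    rw [e]
    refine (uni_apply_norm hvu _).trans ((norm_add_le _ _).trans ?_)
    rw [norm_neg]
    have : δ * ‖star v * X‖ ≤ δ * ‖X‖ := by gcongr
    linarith
  set η2 := δ / (r + 1) with hη2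
  have hη20 : 0 < η2 := by positivity
  have hη2δ : r * η2 ≤ δ := by
    rw [hη2, ← mul_div_assoc, div_le_iff₀ (by positivity)]; nlinarith
  obtain ⟨κ2, t2, c2, v2, hc20, hc21, hv2, hav2⟩ := averaging hω hU hτ N hNM hirr b
    (fun i => hAM n (hb i)) (Set.range (fun i => x (ti i)) ∪ Set.range ti)
    ((Set.finite_range _).union (Set.finite_range _)) η2 hη20
  refine ⟨∑ i, τ (b i) • ti i, fun X hX => ?_⟩
  have hXV : ∀ i, X (ti i) ∈ (Set.range (fun i => x (ti i)) ∪ Set.range ti) := by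
    intro i
    rcases hX with rfl | rfl
    · exact Or.inl ⟨i, rfl⟩
    · exact Or.inr ⟨i, rfl⟩
  have f1 : ‖∑ i, (∑ s ∈ t2, (c2 s : ℂ) • (v2 s * b i * star (v2 s)) - τ (b i) • 1) (X (ti i))‖ ≤ δ := by
    refine (norm_sum_le _ _).trans ?_
    refine (Finset.sum_le_sum fun i _ => hav2 i _ (hXV i)).trans ?_
    simpa using hη2δ
  have f2 : ‖∑ s ∈ t2, (c2 s : ℂ) • (y (X w) - ∑ i, (v2 s * b i * star (v2 s)) (X (ti i)))‖
      ≤ δ * (1 + ‖X‖) := by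
    refine (norm_sum_le _ _).trans ?_
    calc _ ≤ ∑ s ∈ t2, c2 s * (δ * (1 + ‖X‖)) := by
          refine Finset.sum_le_sum fun s hs => ?_
          rw [norm_smul, Complex.norm_real, Real.norm_of_nonneg (hc20 s hs)]
          exact mul_le_mul_of_nonneg_left (est2 X hX _ (hv2 s hs).1 (hv2 s hs).2) (hc20 s hs)
      _ = _ := by rw [← Finset.sum_mul, hc21, one_mul]
  have f3 : y (X w) - X (∑ i, τ (b i) • ti i) =
      ∑ s ∈ t2, (c2 s : ℂ) • (y (X w) - ∑ i, (v2 s * b i * star (v2 s)) (X (ti i))) +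
      ∑ i, (∑ s ∈ t2, (c2 s : ℂ) • (v2 s * b i * star (v2 s)) - τ (b i) • 1) (X (ti i)) := by
    have g1 : ∑ s ∈ t2, (c2 s : ℂ) = 1 := by rw [← Complex.ofReal_sum, hc21, Complex.ofReal_one]
    have g2 : ∑ s ∈ t2, (c2 s : ℂ) • (y (X w) - ∑ i, (v2 s * b i * star (v2 s)) (X (ti i)))
        = y (X w) - ∑ i, ∑ s ∈ t2, (c2 s : ℂ) • (v2 s * b i * star (v2 s)) (X (ti i)) := by
      simp only [smul_sub, Finset.sum_sub_distrib, ← Finset.sum_smul, g1, one_smul,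
        Finset.smul_sum]
      rw [Finset.sum_comm]
    rw [g2]
    simp only [sub_apply, sum_apply, smul_apply, one_apply, Finset.sum_sub_distrib, map_sum,
      map_smul]
    abel
  rw [f3]
  refine (norm_add_le _ _).trans ?_
  linarith

theorem comm_main (hω : IsFreeUltrafilter ω) (hU : IsTracialUltrapower ω M Mω τ limω)
    (hM : IsII1Factor M τ) (hMhf : IsHyperfinite M) (N : VonNeumannAlgebra H)
    (hNM : (N : Set (Op H)) ⊆ (M : Set (Op H)))
    (hirr : relComm (N : Set (Op H)) (M : Set (Op H)) = scalars H)
    (hcs : relComm (M : Set (Op H)) (Mω : Set (Op H)) ⊆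
      ultrapowerSet limω (N : Set (Op H)))
    (y : Op H) (hy : ∀ g ∈ N, g * y = y * g) (x : Op H) (hx : x ∈ M) : y * x = x * y := by
  ext w
  change y (x w) = x (y w)
  rw [← sub_eq_zero, ← norm_eq_zero]
  refine le_antisymm (le_of_forall_pos_le_add fun ε hε => ?_) (norm_nonneg _)
  set D := (2 + ‖x‖) + ‖x‖ * (2 + ‖(1 : Op H)‖) with hD
  have hD0 : 0 < D := by positivity
  obtain ⟨t', ht⟩ := main_est hω hU hM hMhf N hNM hirr hcs y hy x hx w (ε / D) (by positivity)
  have h1 := ht x (Or.inl rfl)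
  have h2 := ht 1 (Or.inr rfl)
  have e : y (x w) - x (y w) = (y (x w) - x t') - x (y w - t') := by rw [map_sub]; abel
  have h3 : ‖x (y w - t')‖ ≤ ‖x‖ * (ε / D * (2 + ‖(1 : Op H)‖)) :=
    (x.le_opNorm _).trans (mul_le_mul_of_nonneg_left h2 (norm_nonneg _))
  rw [e]
  refine (norm_sub_le _ _).trans ?_
  have : ε / D * (2 + ‖x‖) + ‖x‖ * (ε / D * (2 + ‖(1 : Op H)‖)) = ε := by
    have : ε / D * (2 + ‖x‖) + ‖x‖ * (ε / D * (2 + ‖(1 : Op H)‖)) = ε / D * D := by rw [hD]; ring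
    rw [this, div_mul_cancel₀ _ hD0.ne']
  linarith
end

/-- Popa's question, answered affirmatively.
If `N ⊆ M` is an irreducible inclusion of hyperfinite II₁ factors, `ω` is a free
ultrafilter on ℕ, and the central sequence algebra `M' ∩ M^ω` is contained in `N^ω`,
then `N = M`. -/
theorem central_sequence_absorption
    {H : Type u} [NormedAddCommGroup H] [InnerProductSpace ℂ H] [CompleteSpace H]
    (ω : Ultrafilter ℕ) (hω : IsFreeUltrafilter ω)
    (M N Mω : VonNeumannAlgebra H) (τ : Op H →ₗ[ℂ] ℂ) (limω : (ℕ → Op H) → Op H)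
    (hM : IsII1Factor M τ) (hN : IsII1Factor N τ)
    (hMhf : IsHyperfinite M) (hNhf : IsHyperfinite N)
    (hNM : (N : Set (Op H)) ⊆ (M : Set (Op H)))
    (hirr : relComm (N : Set (Op H)) (M : Set (Op H)) = scalars H)
    (hU : IsTracialUltrapower ω M Mω τ limω)
    (hcs : relComm (M : Set (Op H)) (Mω : Set (Op H)) ⊆
      ultrapowerSet limω (N : Set (Op H))) :
    N = M := by
  apply VonNeumannAlgebra.ext
  intro x
  exact ⟨fun h => hNM h, fun hx => vn_mem_of_comm N fun y hy =>
    comm_main hω hU hM hMhf N hNM hirr hcs y hy x hx⟩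

end PopaQ
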